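/- arXiv:2310.00531 — 11 statements merged into one kernel-verified Lean document; each statement's English description precedes it below -/
import Mathlib

section
/- Let X be a topological space, let Y ⊆ ℝⁿ be a convex set satisfying property (A), and let F be a correspondence from X to Y whose upper sections F(x) are separately convex for every x ∈ X. Then the graph of F is open in X × Y if and only if F has open lower sections and separately open upper sections. -/
open Set

/-- `L` is a straight line in `Y`: the intersection of `Y` with a
one-dimensional affine subspace of `ℝⁿ`. -/
def IsLineIn {n : ℕ} (Y L : Set (Fin n → ℝ)) : Prop :=
  ∃ (p v : Fin n → ℝ), v ≠ 0 ∧ L = Y ∩ {z | ∃ t : ℝ, z = p + t • v}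

/-- `L` is a straight line in `Y` parallel to the `i`-th coordinate axis. -/
def IsAxisLineIn {n : ℕ} (Y L : Set (Fin n → ℝ)) : Prop :=
  ∃ (p : Fin n → ℝ) (i : Fin n), L = Y ∩ {z | ∃ t : ℝ, z = p + t • (Pi.single i 1 : Fin n → ℝ)}

/-- `A` is separately convex in `Y`. -/
def SepConvexIn {n : ℕ} (Y A : Set (Fin n → ℝ)) : Prop :=
  ∀ L, IsAxisLineIn Y L → Convex ℝ (A ∩ L)

/-- Property (A): `Y` is open or a product of subsets of `ℝ`. -/
def PropertyA {n : ℕ} (Y : Set (Fin n → ℝ)) : Prop :=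
  IsOpen Y ∨ ∃ Yi : Fin n → Set ℝ, Y = Set.univ.pi Yi

open Filter Topology

/-- Inside an order-connected set of reals, every relative neighbourhood of a point `y` contains
the endpoints of a relative neighbourhood of `y` that is a closed interval. -/
lemma exists_Icc_mem_nhdsWithin {Z N : Set ℝ} (hZ : Z.OrdConnected) {y : ℝ} (hy : y ∈ Z)
    (hN : N ∈ 𝓝[Z] y) :
    ∃ a ∈ Z ∩ N, ∃ b ∈ Z ∩ N, Icc a b ∈ 𝓝[Z] y := by
  obtain ⟨ε, hε, hball⟩ := Metric.mem_nhdsWithin_iff.1 hN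
  have hyN : y ∈ N := hball ⟨Metric.mem_ball_self hε, hy⟩
  have hlow : ∃ a ∈ Z ∩ N, Ici a ∈ 𝓝[Z] y := by
    by_cases h : ∃ z ∈ Z, z < y
    · obtain ⟨z, hz, hzy⟩ := h
      have hlt : max z (y - ε / 2) < y := max_lt hzy (by linarith)
      have hmem : max z (y - ε / 2) ∈ Z := hZ.out hz hy ⟨le_max_left _ _, hlt.le⟩
      refine ⟨_, ⟨hmem, hball ⟨?_, hmem⟩⟩, mem_nhdsWithin_of_mem_nhds (Ici_mem_nhds hlt)⟩
      rw [Metric.mem_ball, Real.dist_eq, abs_lt]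
      constructor <;> linarith [le_max_right z (y - ε / 2)]
    · push Not at h
      exact ⟨y, ⟨hy, hyN⟩, mem_of_superset self_mem_nhdsWithin h⟩
  have hupp : ∃ b ∈ Z ∩ N, Iic b ∈ 𝓝[Z] y := by
    by_cases h : ∃ z ∈ Z, y < z
    · obtain ⟨z, hz, hzy⟩ := h
      have hlt : y < min z (y + ε / 2) := lt_min hzy (by linarith)
      have hmem : min z (y + ε / 2) ∈ Z := hZ.out hy hz ⟨hlt.le, min_le_left _ _⟩
      refine ⟨_, ⟨hmem, hball ⟨?_, hmem⟩⟩, mem_nhdsWithin_of_mem_nhds (Iic_mem_nhds hlt)⟩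
      rw [Metric.mem_ball, Real.dist_eq, abs_lt]
      constructor <;> linarith [min_le_right z (y + ε / 2)]
    · push Not at h
      exact ⟨y, ⟨hy, hyN⟩, mem_of_superset self_mem_nhdsWithin h⟩
  obtain ⟨a, ha, hanhds⟩ := hlow
  obtain ⟨b, hb, hbnhds⟩ := hupp
  exact ⟨a, ha, b, hb, inter_mem hanhds hbnhds⟩

/-- Changing the `i`-th coordinate stays on the line through `p` in direction `i`. -/
lemma update_eq_add_smul_single {n : ℕ} (p : Fin n → ℝ) (i : Fin n) (t : ℝ) :
    Function.update p i t = p + (t - p i) • (Pi.single i 1 : Fin n → ℝ) := by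
  ext k
  rcases eq_or_ne k i with rfl | hk
  · simp
  · simp [hk]

/-- Convex sets with property (A) are locally products of order-connected sets. -/
lemma PropertyA.exists_local_pi {n : ℕ} {Y : Set (Fin n → ℝ)} (hYA : PropertyA Y)
    (hYconv : Convex ℝ Y) {y : Fin n → ℝ} (hy : y ∈ Y) :
    ∃ Z : Fin n → Set ℝ, (∀ i, (Z i).OrdConnected) ∧ y ∈ univ.pi Z ∧ univ.pi Z ⊆ Y ∧
      univ.pi Z ∈ 𝓝[Y] y := by
  rcases hYA with hopen | ⟨Yi, rfl⟩
  · obtain ⟨ε, hε, hball⟩ := Metric.isOpen_iff.1 hopen y hy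
    have hpi : univ.pi (fun i => Metric.ball (y i) ε) = Metric.ball y ε := (ball_pi y hε).symm
    refine ⟨fun i => Metric.ball (y i) ε, fun i => (convex_ball _ _).ordConnected, ?_, ?_, ?_⟩
    · rw [hpi]; exact Metric.mem_ball_self hε
    · rwa [hpi]
    · rw [hpi]; exact mem_nhdsWithin_of_mem_nhds (Metric.ball_mem_nhds y hε)
  · refine ⟨Yi, fun i => ?_, hy, Subset.rfl, self_mem_nhdsWithin⟩
    have himage : Function.eval i '' univ.pi Yi = Yi i := eval_image_univ_pi ⟨y, hy⟩
    rw [← himage]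
    exact (hYconv.linear_image (LinearMap.proj i : (Fin n → ℝ) →ₗ[ℝ] ℝ)).ordConnected

/-- A separately convex set containing the vertices of a box contains the box. -/
lemma SepConvexIn.pi_Icc_subset {n : ℕ} {Y A : Set (Fin n → ℝ)} (hA : SepConvexIn Y A)
    (hAY : A ⊆ Y) {a b : Fin n → ℝ} (hvert : univ.pi (fun i => {a i, b i}) ⊆ A) :
    univ.pi (fun i => Icc (a i) (b i)) ⊆ A := by
  have key : ∀ s : Finset (Fin n), ∀ v : Fin n → ℝ, (∀ i ∈ s, v i ∈ Icc (a i) (b i)) →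
      (∀ i ∉ s, v i ∈ ({a i, b i} : Set ℝ)) → v ∈ A := by
    intro s
    induction s using Finset.induction_on with
    | empty => exact fun v _ hv => hvert fun i _ => hv i (by simp)
    | insert j s hj ih =>
      intro v hs hns
      have hupdate : ∀ c ∈ ({a j, b j} : Set ℝ), Function.update v j c ∈ A := by
        intro c hc
        refine ih _ (fun i hi => ?_) (fun i hi => ?_)
        · have hij : i ≠ j := fun h => hj (h ▸ hi)
          simpa [hij] using hs i (Finset.mem_insert_of_mem hi)
        · rcases eq_or_ne i j with rfl | hij
          · simpa using hc
          · simpa [hij] using hns i (by simp [hij, hi])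
      have hline : ∀ c ∈ ({a j, b j} : Set ℝ), Function.update v j c ∈
          A ∩ (Y ∩ {z | ∃ t : ℝ, z = v + t • (Pi.single j 1 : Fin n → ℝ)}) := fun c hc =>
        ⟨hupdate c hc, hAY (hupdate c hc), c - v j, update_eq_add_smul_single v j c⟩
      have hconv := hA _ ⟨v, j, rfl⟩
      have hvj : v j ∈ segment ℝ (a j) (b j) := by
        have h := hs j (Finset.mem_insert_self j s)
        rwa [segment_eq_Icc (h.1.trans h.2)]
      obtain ⟨α, β, hα, hβ, hαβ, hcomb⟩ := hvj
      have hmem := hconv (hline (a j) (by simp)) (hline (b j) (by simp)) hα hβ hαβ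
      convert hmem.1 using 1
      ext k
      rcases eq_or_ne k j with rfl | hk
      · simpa using hcomb.symm
      · simp [hk, ← add_mul, hαβ]
  exact fun v hv => key Finset.univ v (fun i _ => hv i trivial) (fun i hi => by simp at hi)

/-- If `A` is relatively open along the axis-parallel lines of `Y`, then moving a point of `A`
slightly in one coordinate, without leaving `Y`, stays in `A`. -/
lemma eventually_update_mem {n : ℕ} {Y A : Set (Fin n → ℝ)}
    (hA : ∀ L, IsAxisLineIn Y L → IsOpen (Subtype.val ⁻¹' A : Set L))
    {v : Fin n → ℝ} (hvY : v ∈ Y) (hv : v ∈ A) (j : Fin n) {Z : Set ℝ}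
    (hZ : ∀ t ∈ Z, Function.update v j t ∈ Y) :
    ∀ᶠ t in 𝓝[Z] (v j), Function.update v j t ∈ A := by
  obtain ⟨O, hO, hOA⟩ := isOpen_induced_iff.1
    (hA (Y ∩ {z | ∃ t : ℝ, z = v + t • (Pi.single j 1 : Fin n → ℝ)}) ⟨v, j, rfl⟩)
  have hiff : ∀ t, Function.update v j t ∈ Y →
      (Function.update v j t ∈ O ↔ Function.update v j t ∈ A) := fun t ht =>
    Set.ext_iff.1 hOA ⟨_, ht, t - v j, update_eq_add_smul_single v j t⟩
  have hvO : Function.update v j (v j) ∈ O := by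
    rw [hiff _ (by rwa [Function.update_eq_self])]
    rwa [Function.update_eq_self]
  have hcont : Continuous fun t : ℝ => Function.update v j t :=
    continuous_const.update j continuous_id
  have hev : ∀ᶠ t in 𝓝 (v j), Function.update v j t ∈ O :=
    hcont.continuousAt.eventually_mem (hO.mem_nhds hvO)
  filter_upwards [mem_nhdsWithin_of_mem_nhds hev, self_mem_nhdsWithin] with t ht htZ
  exact (hiff t (hZ t htZ)).1 ht

/-- If `A` is relatively open along the axis-parallel lines of `Y`, every point of `A` has, in
each product of order-connected sets inside `Y` that contains it, a box neighbourhood whose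
vertices lie in `A`. -/
lemma exists_box_vertices_subset {n : ℕ} {Y A : Set (Fin n → ℝ)}
    (hA : ∀ L, IsAxisLineIn Y L → IsOpen (Subtype.val ⁻¹' A : Set L))
    {Z : Fin n → Set ℝ} (hZ : ∀ i, (Z i).OrdConnected) (hZY : univ.pi Z ⊆ Y)
    {y : Fin n → ℝ} (hyZ : y ∈ univ.pi Z) (hyA : y ∈ A) :
    ∃ a b : Fin n → ℝ,
      (∀ i, Icc (a i) (b i) ∈ 𝓝[Z i] (y i)) ∧ univ.pi (fun i => {a i, b i}) ⊆ A := by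
  have key : ∀ s : Finset (Fin n), ∃ a b : Fin n → ℝ, a ∈ univ.pi Z ∧ b ∈ univ.pi Z ∧
      (∀ i ∈ s, Icc (a i) (b i) ∈ 𝓝[Z i] (y i)) ∧ (∀ i ∉ s, a i = y i ∧ b i = y i) ∧
      univ.pi (fun i => {a i, b i}) ⊆ A := by
    intro s
    induction s using Finset.induction_on with
    | empty =>
      refine ⟨y, y, hyZ, hyZ, by simp, by simp, fun v hv => ?_⟩
      have hvy : v = y := funext fun i => by simpa using hv i trivial
      rwa [hvy]
    | insert j s hj ih =>
      obtain ⟨a, b, ha, hb, hnhds, hout, hvert⟩ := ih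
      have hfin : (univ.pi fun i => ({a i, b i} : Set ℝ)).Finite :=
        Set.Finite.pi fun i => Set.toFinite _
      have hev : ∀ᶠ t in 𝓝[Z j] (y j), ∀ v ∈ univ.pi (fun i => ({a i, b i} : Set ℝ)),
          Function.update v j t ∈ A := by
        refine (eventually_all_finite hfin).2 fun v hv => ?_
        have hvj : v j = y j := by simpa [hout j hj] using hv j trivial
        rw [← hvj]
        have hvZ : v ∈ univ.pi Z := fun i _ => by
          rcases hv i trivial with h | h
          · exact h ▸ ha i trivial
          · exact (show v i = b i from h) ▸ hb i trivial
        exact eventually_update_mem hA (hZY hvZ) (hvert hv) j fun t ht =>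
          hZY ((update_mem_pi_iff_of_mem hvZ).2 fun _ => ht)
      obtain ⟨c, hc, d, hd, hcd⟩ :=
        exists_Icc_mem_nhdsWithin (hZ j) (hyZ j trivial) hev
      refine ⟨Function.update a j c, Function.update b j d, ?_, ?_, ?_, ?_, ?_⟩
      · exact (update_mem_pi_iff_of_mem ha).2 fun _ => hc.1
      · exact (update_mem_pi_iff_of_mem hb).2 fun _ => hd.1
      · intro i hi
        rcases eq_or_ne i j with rfl | hij
        · simpa using hcd
        · simpa [hij] using hnhds i (Finset.mem_of_mem_insert_of_ne hi hij)
      · intro i hi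
        rw [Finset.mem_insert, not_or] at hi
        simpa [hi.1] using hout i hi.2
      · intro v hv
        have hmem : Function.update v j (y j) ∈ univ.pi (fun i => ({a i, b i} : Set ℝ)) := by
          intro i _
          rcases eq_or_ne i j with rfl | hij
          · simp [hout i hj]
          · simpa [hij] using hv i trivial
        have hvj : v j = c ∨ v j = d := by simpa using hv j trivial
        have hv_eq : Function.update (Function.update v j (y j)) j (v j) = v := by simp
        rw [← hv_eq]
        rcases hvj with h | h <;> rw [h]
        · exact hc.2 _ hmem
        · exact hd.2 _ hmem
  obtain ⟨a, b, -, -, hnhds, -, hvert⟩ := key Finset.univ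
  exact ⟨a, b, fun i => hnhds i (Finset.mem_univ i), hvert⟩

/-- Theorem 1: for a correspondence `F` from a topological space `X` into a convex
set `Y ⊆ ℝⁿ` with property (A) whose upper sections are separately convex, the graph
of `F` is open in `X × Y` iff `F` has open lower sections and separately open upper
sections. -/
theorem theorem1 {X : Type*} [TopologicalSpace X] {n : ℕ} {Y : Set (Fin n → ℝ)}
    (hYconv : Convex ℝ Y) (hYA : PropertyA Y)
    (F : X → Set (Fin n → ℝ)) (hFY : ∀ x, F x ⊆ Y)
    (hFsc : ∀ x, SepConvexIn Y (F x)) :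
    IsOpen {p : X × Y | (p.2 : Fin n → ℝ) ∈ F p.1} ↔
      (∀ y ∈ Y, IsOpen {x : X | y ∈ F x}) ∧
        (∀ x, ∀ L, IsAxisLineIn Y L → IsOpen (Subtype.val ⁻¹' F x : Set L)) := by
  constructor
  · intro h
    refine ⟨fun y hy => ?_, fun x L hL => ?_⟩
    · exact h.preimage (f := fun x => (x, (⟨y, hy⟩ : Y))) (by fun_prop)
    · have hLY : L ⊆ Y := by
        obtain ⟨p, i, rfl⟩ := hL
        exact inter_subset_left
      exact h.preimage (f := fun z : L => (x, (⟨z, hLY z.2⟩ : Y))) (by fun_prop)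
  · rintro ⟨hlow, hupp⟩
    rw [isOpen_iff_mem_nhds]
    rintro ⟨x, y, hyY⟩ hxy
    obtain ⟨Z, hZ, hyZ, hZY, hZnhds⟩ := hYA.exists_local_pi hYconv hyY
    obtain ⟨a, b, hnhds, hvert⟩ :=
      exists_box_vertices_subset (hupp x) hZ hZY hyZ hxy
    have hfin : (univ.pi fun i => ({a i, b i} : Set ℝ)).Finite :=
      Set.Finite.pi fun i => Set.toFinite _
    have hU : ∀ᶠ x' in 𝓝 x, univ.pi (fun i => ({a i, b i} : Set ℝ)) ⊆ F x' :=
      (eventually_all_finite hfin).2 fun v hv =>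
        (hlow v (hFY x (hvert hv))).mem_nhds (hvert hv)
    have hbox : ∀ᶠ y' in 𝓝[Y] y, y' ∈ univ.pi (fun i => Icc (a i) (b i)) := by
      have hle : 𝓝[Y] y ≤ 𝓝[univ.pi Z] y := nhdsWithin_le_of_mem hZnhds
      refine hle ?_
      simp only [mem_univ_pi]
      refine eventually_all.2 fun i => ?_
      exact (continuousAt_apply i y).continuousWithinAt.tendsto_nhdsWithin (t := Z i)
        (fun z (hz : z ∈ univ.pi Z) => hz i trivial) (hnhds i)
    have hbox' : ∀ᶠ y' : Y in 𝓝 ⟨y, hyY⟩,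
        (y' : Fin n → ℝ) ∈ univ.pi (fun i => Icc (a i) (b i)) := by
      rwa [nhdsWithin_eq_map_subtype_coe hyY, eventually_map] at hbox
    filter_upwards [hU.prod_nhds hbox'] with p hp
    exact (hFsc p.1).pi_Icc_subset (hFY p.1) hp.1 hp.2
end

section
/- Let X ⊆ ℝⁿ be a convex set satisfying property (A), and let F be a correspondence from X to X whose upper sections F(x) and lower sections F⁻¹(y) are all separately convex. Then the graph of F is open in X × X if and only if F has separately open upper sections and separately open lower sections. -/
open Set

open Filter Topology Function

theorem mem_axisLine_update {n : ℕ} (y : Fin n → ℝ) (i : Fin n) (t : ℝ) :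
    update y i t ∈ {z | ∃ t : ℝ, z = y + t • (Pi.single i 1 : Fin n → ℝ)} := by
  refine ⟨t - y i, funext fun j => ?_⟩
  by_cases h : j = i
  · subst h; simp
  · simp [h]

theorem eventually_update_mem_of_isOpen_axisLines {n : ℕ} {X S : Set (Fin n → ℝ)}
    (hS : ∀ L, IsAxisLineIn X L → IsOpen (Subtype.val ⁻¹' S : Set L))
    {y : Fin n → ℝ} (hyX : y ∈ X) (hyS : y ∈ S) (i : Fin n) :
    ∀ᶠ t in 𝓝 (y i), update y i t ∈ X → update y i t ∈ S := by
  obtain ⟨O, hO, hOS⟩ := isOpen_induced_iff.1 (hS _ ⟨y, i, rfl⟩)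
  have key : ∀ t, update y i t ∈ X → (update y i t ∈ O ↔ update y i t ∈ S) := fun t ht =>
    Set.ext_iff.1 hOS ⟨update y i t, ht, mem_axisLine_update y i t⟩
  have hyO : update y i (y i) ∈ O := (key _ (by simpa using hyX)).2 (by simpa using hyS)
  have hcont : Continuous fun t => update y i t := continuous_const.update i continuous_id
  filter_upwards [hcont.continuousAt.preimage_mem_nhds (hO.mem_nhds hyO)] with t ht htX
  exact (key t htX).1 ht

theorem SepConvexIn.update_mem {n : ℕ} {X S : Set (Fin n → ℝ)} (hS : SepConvexIn X S)
    (q : Fin n → ℝ) (i : Fin n) {s t u : ℝ} (hst : s ≤ t) (htu : t ≤ u)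
    (hsX : update q i s ∈ X) (huX : update q i u ∈ X)
    (hs : update q i s ∈ S) (hu : update q i u ∈ S) : update q i t ∈ S := by
  have hconv := hS _ ⟨q, i, rfl⟩
  obtain ⟨α, β, hα, hβ, hαβ, rfl⟩ : t ∈ segment ℝ s u := by
    rw [segment_eq_Icc (hst.trans htu)]; exact ⟨hst, htu⟩
  have h := hconv ⟨hs, hsX, mem_axisLine_update q i s⟩ ⟨hu, huX, mem_axisLine_update q i u⟩
    hα hβ hαβ
  convert h.1 using 1
  ext j
  by_cases hj : j = i
  · subst hj; simp
  · simp [hj, ← add_mul, hαβ]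

theorem exists_le_mem_of_mem_nhdsWithin {Z W : Set ℝ} (hZ : Z.OrdConnected) {c : ℝ}
    (hc : c ∈ Z) (hW : W ∈ 𝓝[Z] c) : ∃ a ∈ Z ∩ W, ∀ᶠ t in 𝓝[Z] c, a ≤ t := by
  obtain ⟨ε, hε, hW⟩ := Metric.mem_nhdsWithin_iff.1 hW
  by_cases h : ∃ z ∈ Z, z < c
  · obtain ⟨z, hz, hzc⟩ := h
    have hlt : max z (c - ε / 2) < c := max_lt hzc (by linarith)
    have hmem : max z (c - ε / 2) ∈ Z := hZ.out hz hc ⟨le_max_left _ _, hlt.le⟩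
    refine ⟨_, ⟨hmem, hW ⟨?_, hmem⟩⟩, mem_nhdsWithin_of_mem_nhds (Ici_mem_nhds hlt)⟩
    rw [Metric.mem_ball, Real.dist_eq, abs_lt]
    constructor <;> linarith [le_max_right z (c - ε / 2)]
  · push Not at h
    exact ⟨c, ⟨hc, hW ⟨Metric.mem_ball_self hε, hc⟩⟩,
      eventually_nhdsWithin_of_forall h⟩

theorem exists_ge_mem_of_mem_nhdsWithin {Z W : Set ℝ} (hZ : Z.OrdConnected) {c : ℝ}
    (hc : c ∈ Z) (hW : W ∈ 𝓝[Z] c) : ∃ b ∈ Z ∩ W, ∀ᶠ t in 𝓝[Z] c, t ≤ b := by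
  obtain ⟨ε, hε, hW⟩ := Metric.mem_nhdsWithin_iff.1 hW
  by_cases h : ∃ z ∈ Z, c < z
  · obtain ⟨z, hz, hzc⟩ := h
    have hlt : c < min z (c + ε / 2) := lt_min hzc (by linarith)
    have hmem : min z (c + ε / 2) ∈ Z := hZ.out hc hz ⟨hlt.le, min_le_left _ _⟩
    refine ⟨_, ⟨hmem, hW ⟨?_, hmem⟩⟩, mem_nhdsWithin_of_mem_nhds (Iic_mem_nhds hlt)⟩
    rw [Metric.mem_ball, Real.dist_eq, abs_lt]
    constructor <;> linarith [min_le_right z (c + ε / 2)]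
  · push Not at h
    exact ⟨c, ⟨hc, hW ⟨Metric.mem_ball_self hε, hc⟩⟩,
      eventually_nhdsWithin_of_forall h⟩

section Box

variable {ι : Type*} [DecidableEq ι] {Z : ι → Set ℝ} {A : Set (ι → ℝ)}

/-- Around a point of a separately open set there is a box, a neighborhood in each coordinate,
all of whose vertices (in the directions of `s`) lie in the set. -/
theorem exists_box_vertices_mem [Finite ι] (hZ : ∀ i, (Z i).OrdConnected) {p : ι → ℝ}
    (hpZ : p ∈ univ.pi Z) (hpA : p ∈ A)
    (hopen : ∀ q ∈ univ.pi Z, q ∈ A → ∀ i, ∀ᶠ t in 𝓝[Z i] (q i), update q i t ∈ A)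
    (s : Finset ι) :
    ∃ a b : ι → ℝ, (∀ i, a i ∈ Z i) ∧ (∀ i, b i ∈ Z i) ∧
      (∀ i ∈ s, ∀ᶠ t in 𝓝[Z i] (p i), t ∈ Icc (a i) (b i)) ∧
      ∀ q : ι → ℝ, (∀ i ∈ s, q i = a i ∨ q i = b i) → (∀ i ∉ s, q i = p i) → q ∈ A := by
  induction s using Finset.induction_on with
  | empty =>
    refine ⟨p, p, fun i => hpZ i trivial, fun i => hpZ i trivial, by simp, fun q _ hq => ?_⟩
    rwa [show q = p from funext fun i => hq i (by simp)]
  | insert j s hj ih =>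
    obtain ⟨a, b, ha, hb, hab, hA⟩ := ih
    set V : Set (ι → ℝ) := {q | (∀ i ∈ s, q i = a i ∨ q i = b i) ∧ ∀ i ∉ s, q i = p i} with hV
    have hVfin : V.Finite := by
      refine (Set.Finite.pi' (t := fun i => {a i, b i, p i}) fun i => by simp).subset ?_
      rintro q ⟨hq, hq'⟩ i
      by_cases hi : i ∈ s
      · rcases hq i hi with h | h <;> simp [h]
      · simp [hq' i hi]
    have hW : ∀ᶠ t in 𝓝[Z j] (p j), ∀ q ∈ V, update q j t ∈ A := by
      refine (eventually_all_finite hVfin).2 fun q hq => ?_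
      have hqj : q j = p j := hq.2 j hj
      rw [← hqj]
      refine hopen q (fun i _ => ?_) (hA q hq.1 hq.2) j
      by_cases hi : i ∈ s
      · rcases hq.1 i hi with h | h <;> rw [h]
        exacts [ha i, hb i]
      · rw [hq.2 i hi]; exact hpZ i trivial
    obtain ⟨a', ⟨haZ, haW⟩, hale⟩ :=
      exists_le_mem_of_mem_nhdsWithin (hZ j) (hpZ j trivial) hW
    obtain ⟨b', ⟨hbZ, hbW⟩, hbge⟩ :=
      exists_ge_mem_of_mem_nhdsWithin (hZ j) (hpZ j trivial) hW
    have hne : ∀ i ∈ s, i ≠ j := fun i hi h => hj (h ▸ hi)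
    refine ⟨update a j a', update b j b', ?_, ?_, ?_, fun q hq hq' => ?_⟩
    · intro i
      by_cases h : i = j
      · subst h; simpa using haZ
      · simpa [h] using ha i
    · intro i
      by_cases h : i = j
      · subst h; simpa using hbZ
      · simpa [h] using hb i
    · intro i hi
      by_cases h : i = j
      · subst h; simpa using hale.and hbge
      · simpa [h] using hab i (Finset.mem_of_mem_insert_of_ne hi h)
    · have hqV : update q j (p j) ∈ V := by
        refine ⟨fun i hi => ?_, fun i hi => ?_⟩
        · simpa [hne i hi] using hq i (Finset.mem_insert_of_mem hi)
        · by_cases h : i = j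
          · subst h; simp
          · simpa [h] using hq' i (by simp [h, hi])
      have hqj := hq j (Finset.mem_insert_self j s)
      simp only [update_self] at hqj
      rcases hqj with h | h
      · simpa [← h] using haW _ hqV
      · simpa [← h] using hbW _ hqV

/-- A separately convex set containing the vertices of a box contains the box. -/
theorem box_subset_of_vertices_mem {a b : ι → ℝ} (hZ : ∀ i, (Z i).OrdConnected)
    (ha : ∀ i, a i ∈ Z i) (hb : ∀ i, b i ∈ Z i)
    (hconv : ∀ q ∈ univ.pi Z, ∀ i, ∀ s ∈ Z i, ∀ u ∈ Z i, ∀ t ∈ Icc s u,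
      update q i s ∈ A → update q i u ∈ A → update q i t ∈ A)
    (hA : ∀ q : ι → ℝ, (∀ i, q i = a i ∨ q i = b i) → q ∈ A) (s : Finset ι) :
    ∀ q : ι → ℝ, (∀ i ∈ s, q i ∈ Icc (a i) (b i)) → (∀ i ∉ s, q i = a i ∨ q i = b i) →
      q ∈ A := by
  induction s using Finset.induction_on with
  | empty => exact fun q _ hq => hA q fun i => hq i (by simp)
  | insert j s hj ih =>
    intro q hq hq'
    have hne : ∀ i ∈ s, i ≠ j := fun i hi h => hj (h ▸ hi)
    have hqZ : q ∈ univ.pi Z := fun i _ => by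
      by_cases hi : i ∈ insert j s
      · exact (hZ i).out (ha i) (hb i) (hq i hi)
      · rcases hq' i hi with h | h <;> rw [h]
        exacts [ha i, hb i]
    have hvertex : ∀ t, t = a j ∨ t = b j → update q j t ∈ A := by
      refine fun t ht => ih _ (fun i hi => ?_) fun i hi => ?_
      · simpa [hne i hi] using hq i (Finset.mem_insert_of_mem hi)
      · by_cases h : i = j
        · subst h; simpa using ht
        · simpa [h] using hq' i (by simp [h, hi])
    simpa using hconv q hqZ j (a j) (ha j) (b j) (hb j) (q j) (hq j (Finset.mem_insert_self j s))
      (hvertex _ (.inl rfl)) (hvertex _ (.inr rfl))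

/-- A separately convex and separately open subset of a product of intervals is open. -/
theorem mem_nhdsWithin_pi_of_separately [Fintype ι] (hZ : ∀ i, (Z i).OrdConnected) {p : ι → ℝ}
    (hpZ : p ∈ univ.pi Z) (hpA : p ∈ A)
    (hopen : ∀ q ∈ univ.pi Z, q ∈ A → ∀ i, ∀ᶠ t in 𝓝[Z i] (q i), update q i t ∈ A)
    (hconv : ∀ q ∈ univ.pi Z, ∀ i, ∀ s ∈ Z i, ∀ u ∈ Z i, ∀ t ∈ Icc s u,
      update q i s ∈ A → update q i u ∈ A → update q i t ∈ A) :
    A ∈ 𝓝[univ.pi Z] p := by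
  obtain ⟨a, b, ha, hb, hab, hA⟩ := exists_box_vertices_mem hZ hpZ hpA hopen Finset.univ
  have hbox := box_subset_of_vertices_mem hZ ha hb hconv
    (fun q hq => hA q (fun i _ => hq i) (by simp)) Finset.univ
  have hev : ∀ᶠ q in 𝓝[univ.pi Z] p, ∀ i, q i ∈ Icc (a i) (b i) := by
    refine eventually_all.2 fun i => ?_
    have ht : Tendsto (fun q : ι → ℝ => q i) (𝓝[univ.pi Z] p) (𝓝[Z i] (p i)) :=
      (continuous_apply i).continuousWithinAt.tendsto_nhdsWithin fun q hq => hq i trivial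
    exact ht.eventually (hab i (Finset.mem_univ i))
  filter_upwards [hev] with q hq
  exact hbox q (fun i _ => hq i) (by simp)

end Box

theorem PropertyA.exists_pi_mem_nhdsWithin {n : ℕ} {X : Set (Fin n → ℝ)} (hXA : PropertyA X)
    (hX : Convex ℝ X) {x : Fin n → ℝ} (hx : x ∈ X) :
    ∃ Z : Fin n → Set ℝ, (∀ i, (Z i).OrdConnected) ∧ x ∈ univ.pi Z ∧ univ.pi Z ⊆ X ∧
      univ.pi Z ∈ 𝓝[X] x := by
  rcases hXA with ho | ⟨Y, rfl⟩
  · obtain ⟨ε, hε, hball⟩ := Metric.isOpen_iff.1 ho x hx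
    rw [ball_pi x hε] at hball
    refine ⟨fun i => Metric.ball (x i) ε, fun i => (convex_ball _ _).ordConnected,
      fun i _ => Metric.mem_ball_self hε, hball, mem_nhdsWithin_of_mem_nhds ?_⟩
    rw [← ball_pi x hε]
    exact Metric.ball_mem_nhds x hε
  · refine ⟨Y, fun i => ?_, hx, subset_rfl, self_mem_nhdsWithin⟩
    have h := hX.linear_image (LinearMap.proj (R := ℝ) (φ := fun _ => ℝ) i)
    have himg : eval i '' univ.pi Y = Y i := eval_image_univ_pi ⟨x, hx⟩
    exact (himg ▸ h : Convex ℝ (Y i)).ordConnected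

/-- Corollary 1: for `X ⊆ ℝⁿ` convex with property (A) and a correspondence `F`
from `X` into `X` with separately convex upper and lower sections, the graph of `F`
is open in `X × X` iff `F` has separately open upper and lower sections. -/
theorem corollary1 {n : ℕ} {X : Set (Fin n → ℝ)}
    (hXconv : Convex ℝ X) (hXA : PropertyA X)
    (F : (Fin n → ℝ) → Set (Fin n → ℝ)) (hFX : ∀ x ∈ X, F x ⊆ X)
    (hup : ∀ x ∈ X, SepConvexIn X (F x))
    (hlow : ∀ y ∈ X, SepConvexIn X {x ∈ X | y ∈ F x}) :
    IsOpen {p : X × X | (p.2 : Fin n → ℝ) ∈ F (p.1 : Fin n → ℝ)} ↔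
      (∀ x ∈ X, ∀ L, IsAxisLineIn X L → IsOpen (Subtype.val ⁻¹' F x : Set L)) ∧
        (∀ y ∈ X, ∀ L, IsAxisLineIn X L →
          IsOpen (Subtype.val ⁻¹' {x | y ∈ F x} : Set L)) := by
  constructor
  · refine fun hF => ⟨fun x hx L hL => ?_, fun y hy L hL => ?_⟩
    · have hLX : L ⊆ X := by obtain ⟨p, i, rfl⟩ := hL; exact inter_subset_left
      exact hF.preimage (f := fun l : L => ((⟨x, hx⟩, ⟨l, hLX l.2⟩) : X × X)) (by fun_prop)
    · have hLX : L ⊆ X := by obtain ⟨p, i, rfl⟩ := hL; exact inter_subset_left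
      exact hF.preimage (f := fun l : L => ((⟨l, hLX l.2⟩, ⟨y, hy⟩) : X × X)) (by fun_prop)
  rintro ⟨hupo, hlowo⟩
  rw [isOpen_iff_mem_nhds]
  rintro ⟨⟨x, hx⟩, ⟨y, hy⟩⟩ hxy
  obtain ⟨Zx, hZx, hxZ, hZxX, hZxn⟩ := hXA.exists_pi_mem_nhdsWithin hXconv hx
  obtain ⟨Zy, hZy, hyZ, hZyX, hZyn⟩ := hXA.exists_pi_mem_nhdsWithin hXconv hy
  set Z : Fin n ⊕ Fin n → Set ℝ := Sum.elim Zx Zy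
  set A : Set (Fin n ⊕ Fin n → ℝ) := {z | z ∘ Sum.inr ∈ F (z ∘ Sum.inl)}
  have hl : ∀ q ∈ univ.pi Z, q ∘ Sum.inl ∈ univ.pi Zx := fun q hq i _ => hq (.inl i) trivial
  have hr : ∀ q ∈ univ.pi Z, q ∘ Sum.inr ∈ univ.pi Zy := fun q hq i _ => hq (.inr i) trivial
  have hpi : ∀ {W : Fin n → Set ℝ} {w : Fin n → ℝ} {i : Fin n} {t : ℝ}, w ∈ univ.pi W →
      t ∈ W i → update w i t ∈ univ.pi W := fun hw ht => (update_mem_pi_iff_of_mem hw).2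
        fun _ => ht
  have hA : A ∈ 𝓝[univ.pi Z] (Sum.elim x y) := by
    refine mem_nhdsWithin_pi_of_separately ?_ ?_ hxy ?_ ?_
    · rintro (i | i)
      exacts [hZx i, hZy i]
    · rintro (i | i) -
      exacts [hxZ i trivial, hyZ i trivial]
    · rintro q hq hqA (i | i)
      · have h := eventually_update_mem_of_isOpen_axisLines (hlowo _ (hZyX (hr q hq)))
          (hZxX (hl q hq)) hqA i
        filter_upwards [mem_nhdsWithin_of_mem_nhds h, self_mem_nhdsWithin] with t ht htZ
        simpa [A] using ht (hZxX (hpi (hl q hq) htZ))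
      · have h := eventually_update_mem_of_isOpen_axisLines (hupo _ (hZxX (hl q hq)))
          (hZyX (hr q hq)) hqA i
        filter_upwards [mem_nhdsWithin_of_mem_nhds h, self_mem_nhdsWithin] with t ht htZ
        simpa [A] using ht (hZyX (hpi (hr q hq) htZ))
    · rintro q hq (i | i) s hs u hu t ⟨hst, htu⟩ hsA huA
      · have hsX := hZxX (hpi (hl q hq) hs)
        have huX := hZxX (hpi (hl q hq) hu)
        simp only [A, mem_ofPred_eq, Sum.update_inl_comp_inl, Sum.update_inl_comp_inr]
          at hsA huA ⊢
        exact ((hlow _ (hZyX (hr q hq))).update_mem _ i hst htu hsX huX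
          ⟨hsX, hsA⟩ ⟨huX, huA⟩).2
      · have hsX := hZyX (hpi (hr q hq) hs)
        have huX := hZyX (hpi (hr q hq) hu)
        simp only [A, mem_ofPred_eq, Sum.update_inr_comp_inl, Sum.update_inr_comp_inr]
          at hsA huA ⊢
        exact (hup _ (hZxX (hl q hq))).update_mem _ i hst htu hsX huX hsA huA
  have hcont : Continuous fun p : X × X => (Sum.elim p.1.1 p.2.1 : Fin n ⊕ Fin n → ℝ) := by
    refine continuous_pi ?_
    rintro (i | i)
    exacts [(continuous_apply i).comp (continuous_subtype_val.comp continuous_fst),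
      (continuous_apply i).comp (continuous_subtype_val.comp continuous_snd)]
  have h1 : ∀ᶠ p : X × X in 𝓝 (⟨x, hx⟩, ⟨y, hy⟩), p.1.1 ∈ univ.pi Zx :=
    (continuous_fst.tendsto ((⟨x, hx⟩, ⟨y, hy⟩) : X × X))
      (preimage_coe_mem_nhds_subtype (a := (⟨x, hx⟩ : X)).2 hZxn)
  have h2 : ∀ᶠ p : X × X in 𝓝 (⟨x, hx⟩, ⟨y, hy⟩), p.2.1 ∈ univ.pi Zy :=
    (continuous_snd.tendsto ((⟨x, hx⟩, ⟨y, hy⟩) : X × X))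
      (preimage_coe_mem_nhds_subtype (a := (⟨y, hy⟩ : X)).2 hZyn)
  refine tendsto_nhdsWithin_of_tendsto_nhds_of_eventually_within _
    (hcont.tendsto ((⟨x, hx⟩, ⟨y, hy⟩) : X × X)) ?_ hA
  filter_upwards [h1, h2] with p hp1 hp2
  rintro (i | i) -
  exacts [hp1 i trivial, hp2 i trivial]
end

section
/- Let X be a topological space, let Y ⊆ ℝⁿ be a convex set satisfying property (B), and let F be a correspondence from X to Y such that F(x) is convex for every x ∈ X. Then the graph of F is open in X × Y if and only if F has open lower sections and linearly open upper sections. -/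
open Set

/-- Property (B): `Y` is open or a polyhedron (an intersection of finitely many
closed half-spaces). -/
def PropertyB {n : ℕ} (Y : Set (Fin n → ℝ)) : Prop :=
  IsOpen Y ∨ ∃ (m : ℕ) (a : Fin m → Fin n → ℝ) (b : Fin m → ℝ),
    Y = {z | ∀ k, ∑ i, a k i * z i ≤ b k}

/-- An intersection of finitely many closed half-spaces, in terms of continuous linear
functionals. -/
def IsPolyhedral {E : Type*} [AddCommGroup E] [Module ℝ E] [TopologicalSpace E]
    (P : Set E) : Prop :=
  ∃ C : Set ((E →L[ℝ] ℝ) × ℝ), C.Finite ∧ P = {z | ∀ c ∈ C, c.1 z ≤ c.2}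

theorem IsPolyhedral.inter {E : Type*} [AddCommGroup E] [Module ℝ E] [TopologicalSpace E]
    {P Q : Set E} (hP : IsPolyhedral P) (hQ : IsPolyhedral Q) : IsPolyhedral (P ∩ Q) := by
  obtain ⟨C, hC, rfl⟩ := hP
  obtain ⟨D, hD, rfl⟩ := hQ
  refine ⟨C ∪ D, hC.union hD, ?_⟩
  ext z
  simp only [mem_inter_iff, mem_ofPred_eq, mem_union, or_imp, forall_and]

theorem IsPolyhedral.convex {E : Type*} [AddCommGroup E] [Module ℝ E] [TopologicalSpace E]
    {P : Set E} (hP : IsPolyhedral P) : Convex ℝ P := by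
  obtain ⟨C, -, rfl⟩ := hP
  simp only [ofPred_forall]
  exact convex_iInter₂ fun c _ => convex_halfSpace_le c.1.isLinear c.2

theorem isPolyhedral_of_forall_sum_le {ι κ : Type*} [Finite κ] [Fintype ι]
    (a : κ → ι → ℝ) (b : κ → ℝ) :
    IsPolyhedral {z : ι → ℝ | ∀ k, ∑ i, a k i * z i ≤ b k} := by
  refine ⟨range fun k => (∑ i, a k i • ContinuousLinearMap.proj (R := ℝ) (φ := fun _ : ι => ℝ) i,
    b k), finite_range _, ?_⟩
  ext z
  simp

theorem isPolyhedral_closedBall {ι : Type*} [Fintype ι] (y : ι → ℝ) {r : ℝ} (hr : 0 ≤ r) :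
    IsPolyhedral (Metric.closedBall y r) := by
  have hle : IsPolyhedral {z : ι → ℝ | ∀ i, z i ≤ y i + r} :=
    ⟨range fun i => (ContinuousLinearMap.proj (R := ℝ) (φ := fun _ : ι => ℝ) i, y i + r),
      finite_range _, by ext z; simp⟩
  have hge : IsPolyhedral {z : ι → ℝ | ∀ i, -z i ≤ r - y i} :=
    ⟨range fun i => (-ContinuousLinearMap.proj (R := ℝ) (φ := fun _ : ι => ℝ) i, r - y i),
      finite_range _, by ext z; simp⟩
  convert hle.inter hge using 1
  ext z
  simp only [Metric.mem_closedBall, dist_pi_le_iff hr, Real.dist_eq, abs_le, mem_inter_iff,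
    mem_ofPred_eq, ← forall_and]
  refine forall_congr' fun i => ⟨fun h => ⟨?_, ?_⟩, fun h => ⟨?_, ?_⟩⟩ <;> linarith [h.1, h.2]

/-- A polyhedral set agrees near each of its points with its tangent cone there, hence absorbs
dilations centred at that point. -/
theorem IsPolyhedral.eventually_homothety_mem {E : Type*} [AddCommGroup E] [Module ℝ E]
    [TopologicalSpace E] [IsTopologicalAddGroup E] [ContinuousSMul ℝ E]
    {P : Set E} (hP : IsPolyhedral P) {y : E} (hy : y ∈ P) {t : ℝ} (ht : 0 ≤ t) :
    ∀ᶠ z in nhdsWithin y P, AffineMap.homothety y t z ∈ P := by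
  obtain ⟨C, hC, rfl⟩ := hP
  simp only [mem_ofPred_eq, Filter.eventually_all_finite hC]
  intro c hc
  simp only [AffineMap.homothety_apply, vsub_eq_sub, vadd_eq_add]
  rcases (hy c hc).eq_or_lt with h | h
  · filter_upwards [self_mem_nhdsWithin] with z hz
    have := hz c hc
    simp only [map_add, map_smul, map_sub, smul_eq_mul]
    nlinarith
  · have hcont : Continuous fun z : E => c.1 (t • (z - y) + y) := by fun_prop
    have := hcont.continuousAt.eventually_lt (continuousAt_const (y := c.2)) (x₀ := y) (by simpa)
    exact (this.filter_mono nhdsWithin_le_nhds).mono fun z hz => hz.le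

/-- Extreme points are determined by the constraints that they saturate. -/
theorem IsPolyhedral.finite_extremePoints {E : Type*} [AddCommGroup E] [Module ℝ E]
    [TopologicalSpace E] [IsTopologicalAddGroup E] [ContinuousSMul ℝ E]
    {P : Set E} (hP : IsPolyhedral P) : (P.extremePoints ℝ).Finite := by
  obtain ⟨C, hC, rfl⟩ := hP
  refine Finite.of_finite_image (f := fun x => {c ∈ C | c.1 x = c.2})
    (hC.finite_subsets.subset ?_) ?_
  · rintro _ ⟨x, -, rfl⟩
    exact sep_subset _ _
  intro x hx y hy hxy
  have hact : ∀ c ∈ C, c.1 x = c.2 → c.1 y = c.2 := fun c hc h =>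
    ((Set.ext_iff.1 hxy c).1 ⟨hc, h⟩).2
  have hev : ∀ᶠ t : ℝ in nhdsWithin 0 (Ioi 0), ∀ c ∈ C, c.1 (x - t • (y - x)) ≤ c.2 := by
    rw [Filter.eventually_all_finite hC]
    intro c hc
    rcases (hx.1 c hc).eq_or_lt with h | h
    · exact Filter.Eventually.of_forall fun t => by simp [h, hact c hc h]
    · have hcont : Continuous fun t : ℝ => c.1 (x - t • (y - x)) := by fun_prop
      have := hcont.continuousAt.eventually_lt (continuousAt_const (y := c.2)) (x₀ := 0)
        (by simpa)
      exact (this.filter_mono nhdsWithin_le_nhds).mono fun z hz => hz.le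
  obtain ⟨t, ht, ht0⟩ := (hev.and self_mem_nhdsWithin).exists
  have ht0 : 0 < t := ht0
  refine ((mem_extremePoints.1 hx).2 _ ht y hy.1 ⟨1 / (1 + t), t / (1 + t), by positivity,
    by positivity, by field_simp, ?_⟩).2.symm
  have h1 : (1 : ℝ) + t ≠ 0 := by positivity
  match_scalars <;> field_simp <;> ring

/-- A compact polyhedral set is a polytope. -/
theorem IsPolyhedral.exists_finite_convexHull_eq {E : Type*} [NormedAddCommGroup E]
    [NormedSpace ℝ E] {P : Set E} (hP : IsPolyhedral P) (hc : IsCompact P) :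
    ∃ S : Set E, S.Finite ∧ convexHull ℝ S = P :=
  ⟨P.extremePoints ℝ, hP.finite_extremePoints, by
    rw [← (hP.finite_extremePoints.isClosed_convexHull ℝ).closure_eq,
      closure_convexHull_extremePoints hc hP.convex]⟩

theorem PropertyB.exists_isPolyhedral_inter_closedBall {n : ℕ} {Y : Set (Fin n → ℝ)}
    (hY : PropertyB Y) {y : Fin n → ℝ} (hy : y ∈ Y) :
    ∃ r > 0, IsPolyhedral (Y ∩ Metric.closedBall y r) ∧ IsCompact (Y ∩ Metric.closedBall y r) := by
  rcases hY with ho | ⟨m, a, b, rfl⟩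
  · obtain ⟨r, hr, hrY⟩ := Metric.nhds_basis_closedBall.mem_iff.1 (ho.mem_nhds hy)
    refine ⟨r, hr, ?_⟩
    rw [inter_eq_right.2 hrY]
    exact ⟨isPolyhedral_closedBall y hr.le, isCompact_closedBall y r⟩
  · refine ⟨1, one_pos, (isPolyhedral_of_forall_sum_le a b).inter
      (isPolyhedral_closedBall y zero_le_one), (isCompact_closedBall y 1).inter_left ?_⟩
    simp only [ofPred_forall]
    exact isClosed_iInter fun k => isClosed_le (by fun_prop) continuous_const

theorem eventually_homothety_mem_of_isOpen_line {n : ℕ} {Y A : Set (Fin n → ℝ)}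
    (hY : Convex ℝ Y) (hA : ∀ L, IsLineIn Y L → IsOpen (Subtype.val ⁻¹' A : Set L))
    {y s : Fin n → ℝ} (hyA : y ∈ A) (hy : y ∈ Y) (hs : s ∈ Y) :
    ∀ᶠ t : ℝ in nhdsWithin 0 (Ioi 0), AffineMap.homothety y t s ∈ A := by
  simp only [AffineMap.homothety_apply, vsub_eq_sub, vadd_eq_add]
  rcases eq_or_ne s y with rfl | hne
  · simpa using hyA
  obtain ⟨U, hU, hUA⟩ := isOpen_induced_iff.1 (hA _ ⟨y, s - y, sub_ne_zero.2 hne, rfl⟩)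
  have hmem : ∀ z ∈ Y ∩ {z | ∃ t : ℝ, z = y + t • (s - y)}, z ∈ U ↔ z ∈ A := fun z hz =>
    Set.ext_iff.1 hUA ⟨z, hz⟩
  have hcont : Continuous fun t : ℝ => t • (s - y) + y := by fun_prop
  have hyU : y ∈ U := (hmem y ⟨hy, 0, by simp⟩).2 hyA
  have hev : ∀ᶠ t : ℝ in nhds 0, t • (s - y) + y ∈ U :=
    hcont.continuousAt.eventually_mem (hU.mem_nhds (by simpa using hyU))
  filter_upwards [hev.filter_mono nhdsWithin_le_nhds, Ioo_mem_nhdsGT one_pos] with t htU ht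
  refine (hmem _ ⟨?_, t, add_comm _ _⟩).1 htU
  rw [add_comm]
  exact hY.add_smul_sub_mem hy hs ⟨ht.1.le, ht.2.le⟩

/-- Theorem 2: for a correspondence `F` from a topological space `X` into a convex
set `Y ⊆ ℝⁿ` with property (B) whose upper sections are convex, the graph of `F` is
open in `X × Y` iff `F` has open lower sections and linearly open upper sections. -/
theorem theorem2 {X : Type*} [TopologicalSpace X] {n : ℕ} {Y : Set (Fin n → ℝ)}
    (hYconv : Convex ℝ Y) (hYB : PropertyB Y)
    (F : X → Set (Fin n → ℝ)) (hFY : ∀ x, F x ⊆ Y)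
    (hFconv : ∀ x, Convex ℝ (F x)) :
    IsOpen {p : X × Y | (p.2 : Fin n → ℝ) ∈ F p.1} ↔
      (∀ y ∈ Y, IsOpen {x : X | y ∈ F x}) ∧
        (∀ x, ∀ L, IsLineIn Y L → IsOpen (Subtype.val ⁻¹' F x : Set L)) := by
  constructor
  · intro h
    refine ⟨fun y hy => h.preimage (f := fun x => (x, (⟨y, hy⟩ : Y))) (by fun_prop),
      fun x L ⟨p, v, _, hL⟩ => ?_⟩
    have hLY : L ⊆ Y := hL ▸ inter_subset_left
    exact h.preimage (f := fun z : L => (x, inclusion hLY z))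
      (continuous_const.prodMk (continuous_inclusion hLY))
  · rintro ⟨hlow, hline⟩
    rw [isOpen_iff_mem_nhds]
    rintro ⟨x, y, hy⟩ (hyx : y ∈ F x)
    obtain ⟨r, hr, hpoly, hcomp⟩ := hYB.exists_isPolyhedral_inter_closedBall hy
    obtain ⟨S, hS, hSP⟩ := hpoly.exists_finite_convexHull_eq hcomp
    have hSY : S ⊆ Y := (subset_convexHull ℝ S).trans (hSP.subset.trans inter_subset_left)
    obtain ⟨t, htF, ht⟩ := (((Filter.eventually_all_finite hS).2 fun s hs =>
      eventually_homothety_mem_of_isOpen_line hYconv (hline x) hyx hy (hSY hs)).and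
        self_mem_nhdsWithin).exists
    have ht : 0 < t := ht
    have hx : ∀ᶠ x' in nhds x, ∀ s ∈ S, AffineMap.homothety y t s ∈ F x' :=
      (Filter.eventually_all_finite hS).2 fun s hs =>
        (hlow _ (hFY x (htF s hs))).mem_nhds (htF s hs)
    have hyev := hpoly.eventually_homothety_mem ⟨hy, Metric.mem_closedBall_self hr.le⟩
      (inv_nonneg.2 ht.le)
    rw [nhdsWithin_inter_of_mem' (mem_nhdsWithin_of_mem_nhds (Metric.closedBall_mem_nhds y hr)),
      nhdsWithin_eq_map_subtype_coe hy, Filter.eventually_map] at hyev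
    rw [nhds_prod_eq]
    filter_upwards [hx.prod_mk hyev] with ⟨x', z⟩ ⟨hx', hz⟩
    rw [← hSP] at hz
    have hmem := convexHull_min (t := AffineMap.homothety y t ⁻¹' F x') hx'
      ((hFconv x').affine_preimage _) hz
    rwa [mem_preimage, ← AffineMap.comp_apply, ← AffineMap.homothety_mul, mul_inv_cancel₀ ht.ne',
      AffineMap.homothety_one, AffineMap.id_apply] at hmem
end

section
/- Let X ⊆ ℝⁿ be a convex set satisfying property (B), and let F be a correspondence from X to X such that F(x) is convex for every x ∈ X and F⁻¹(y) is convex for every y ∈ X. Then the graph of F is open in X × X if and only if F has linearly open upper sections and linearly open lower sections. -/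
open Set

open Filter Topology

/-- A compact polyhedron is the convex hull of finitely many points: its extreme points are
determined by the constraints that are active at them. -/
lemma exists_finite_convexHull_eq_of_isCompact {ι E : Type*} [Finite ι]
    [NormedAddCommGroup E] [NormedSpace ℝ E] (f : ι → E →L[ℝ] ℝ) (b : ι → ℝ)
    (hP : IsCompact {z | ∀ k, f k z ≤ b k}) :
    ∃ S : Set E, S.Finite ∧ convexHull ℝ S = {z | ∀ k, f k z ≤ b k} := by
  set P := {z | ∀ k, f k z ≤ b k} with hPdef
  have hconv : Convex ℝ P := by
    have : P = ⋂ k, {z | f k z ≤ b k} := by ext z; simp [hPdef]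
    rw [this]
    exact convex_iInter fun k => convex_halfSpace_le (f k).toLinearMap.isLinear (b k)
  have hfin : (P.extremePoints ℝ).Finite := by
    refine Set.Finite.of_finite_image (f := fun z => {k | f k z = b k}) (Set.toFinite _) ?_
    intro x hx y hy hxy
    replace hxy : {k | f k x = b k} = {k | f k y = b k} := hxy
    have hev : ∀ᶠ t in 𝓝[>] (0 : ℝ), ∀ k, f k (x - t • (y - x)) ≤ b k := by
      rw [eventually_all]
      intro k
      rcases (hx.1 k).eq_or_lt with h | h
      · have h' : f k y = b k := by
          have : k ∈ {k | f k x = b k} := h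
          rw [hxy] at this
          exact this
        refine Eventually.of_forall fun t => ?_
        simp [h, h']
      · have hc : Continuous fun t : ℝ => f k (x - t • (y - x)) := by fun_prop
        have := hc.continuousAt.eventually_lt (x₀ := (0 : ℝ))
          (continuousAt_const (y := b k)) (by simpa using h)
        exact (this.filter_mono nhdsWithin_le_nhds).mono fun _ => le_of_lt
    obtain ⟨t, ht, htpos⟩ := (hev.and self_mem_nhdsWithin).exists
    replace htpos : 0 < t := htpos
    have hseg : x ∈ openSegment ℝ (x - t • (y - x)) y := by
      refine ⟨1 / (1 + t), t / (1 + t), by positivity, by positivity, by field_simp, ?_⟩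
      have h1 : (1 + t) ≠ 0 := by positivity
      rw [← sub_eq_zero]
      match_scalars <;> field_simp <;> ring
    exact (mem_extremePoints.1 hx |>.2 _ ht _ hy.1 hseg).2.symm
  refine ⟨_, hfin, ?_⟩
  rw [← (hfin.isClosed_convexHull (𝕜 := ℝ)).closure_eq]
  exact closure_convexHull_extremePoints hP hconv

/-- Around each of its points, a polyhedron contains the convex hull of finitely many points
which stays a neighbourhood of the point after contraction. -/
lemma exists_finite_convexHull_homothety_mem_nhdsWithin {ι κ : Type*} [Finite ι] [Fintype κ]
    (f : ι → (κ → ℝ) →L[ℝ] ℝ) (b : ι → ℝ) {x : κ → ℝ} (hx : ∀ k, f k x ≤ b k)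
    {r : ℝ} (hr : 0 < r) :
    ∃ S : Set (κ → ℝ), S.Finite ∧ S ⊆ {z | ∀ k, f k z ≤ b k} ∩ Metric.closedBall x r ∧
      ∀ t : ℝ, 0 < t →
        convexHull ℝ (AffineMap.homothety x t '' S) ∈ 𝓝[{z | ∀ k, f k z ≤ b k}] x := by
  let g : ι ⊕ κ ⊕ κ → (κ → ℝ) →L[ℝ] ℝ :=
    Sum.elim f (Sum.elim (fun i => ContinuousLinearMap.proj i)
      (fun i => -ContinuousLinearMap.proj i))
  let c : ι ⊕ κ ⊕ κ → ℝ :=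
    Sum.elim b (Sum.elim (fun i => x i + r) (fun i => -(x i - r)))
  have hset : {z | ∀ k, g k z ≤ c k} = {z | ∀ k, f k z ≤ b k} ∩ Metric.closedBall x r := by
    ext z
    simp only [mem_ofPred_eq, mem_inter_iff, Metric.mem_closedBall, dist_pi_le_iff hr.le,
      Real.dist_eq, abs_le, Sum.forall, g, c, Sum.elim_inl, Sum.elim_inr,
      ContinuousLinearMap.proj_apply, neg_apply]
    refine and_congr_right fun _ => ⟨fun h i => ?_, fun h => ⟨fun i => ?_, fun i => ?_⟩⟩
    · constructor <;> linarith [h.1 i, h.2 i]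
    · linarith [(h i).2]
    · linarith [(h i).1]
  have hclosed : IsClosed {z | ∀ k, f k z ≤ b k} := by
    simp only [ofPred_forall]
    exact isClosed_iInter fun k => isClosed_le (f k).continuous continuous_const
  obtain ⟨S, hS, hconv⟩ := exists_finite_convexHull_eq_of_isCompact g c
    (hset ▸ (isCompact_closedBall x r).inter_left hclosed)
  rw [hset] at hconv
  refine ⟨S, hS, hconv ▸ subset_convexHull ℝ S, fun t ht => ?_⟩
  rw [← AffineMap.image_convexHull, hconv]
  have hcont : Continuous fun z : κ → ℝ => x + t⁻¹ • (z - x) := by fun_prop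
  have hball : ∀ᶠ z in 𝓝 x, x + t⁻¹ • (z - x) ∈ Metric.closedBall x r :=
    hcont.continuousAt (by simpa using Metric.closedBall_mem_nhds x hr)
  have hcon : ∀ᶠ z in 𝓝[{z | ∀ k, f k z ≤ b k}] x, ∀ k, f k (x + t⁻¹ • (z - x)) ≤ b k := by
    rw [eventually_all]
    intro k
    rcases (hx k).eq_or_lt with h | h
    · filter_upwards [self_mem_nhdsWithin] with z hz
      have := mul_nonpos_of_nonneg_of_nonpos (inv_nonneg.2 ht.le) (sub_nonpos.2 (hz k))
      simpa [h] using this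
    · have := ((f k).continuous.comp hcont).continuousAt.eventually_lt (x₀ := x)
        (continuousAt_const (y := b k)) (by simpa using h)
      exact (this.filter_mono nhdsWithin_le_nhds).mono fun _ => le_of_lt
  filter_upwards [hcon, hball.filter_mono nhdsWithin_le_nhds] with z h1 h2
  refine ⟨_, ⟨h1, h2⟩, ?_⟩
  simp [AffineMap.homothety_apply, smul_smul, ht.ne']

lemma PropertyB.exists_finite_convexHull_homothety_mem_nhdsWithin {n : ℕ}
    {X : Set (Fin n → ℝ)} (hX : PropertyB X) {x : Fin n → ℝ} (hx : x ∈ X) :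
    ∃ S : Set (Fin n → ℝ), S.Finite ∧ S ⊆ X ∧
      ∀ t : ℝ, 0 < t → convexHull ℝ (AffineMap.homothety x t '' S) ∈ 𝓝[X] x := by
  rcases hX with hX | ⟨m, a, b, rfl⟩
  · obtain ⟨r, hr, hrX⟩ := Metric.nhds_basis_closedBall.mem_iff.1 (hX.mem_nhds hx)
    obtain ⟨S, hS, hSX, hSt⟩ := _root_.exists_finite_convexHull_homothety_mem_nhdsWithin
      (ι := Empty) (fun _ => (0 : (Fin n → ℝ) →L[ℝ] ℝ)) (fun _ => 0) (x := x) (by simp) hr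
    refine ⟨S, hS, fun z hz => hrX (hSX hz).2, fun t ht => nhdsWithin_le_nhds ?_⟩
    simpa using hSt t ht
  · let f : Fin m → (Fin n → ℝ) →L[ℝ] ℝ :=
      fun k => ∑ i, a k i • ContinuousLinearMap.proj (R := ℝ) (φ := fun _ => ℝ) i
    have hf : ∀ k z, f k z = ∑ i, a k i * z i := fun k z => by simp [f]
    simp only [← hf, mem_ofPred_eq] at hx ⊢
    obtain ⟨S, hS, hSX, hSt⟩ :=
      _root_.exists_finite_convexHull_homothety_mem_nhdsWithin f b hx one_pos
    exact ⟨S, hS, fun z hz => (hSX hz).1, hSt⟩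

lemma eventually_homothety_mem_of_isOpen_lines {n : ℕ} {X C : Set (Fin n → ℝ)}
    (hX : Convex ℝ X) (hC : ∀ L, IsLineIn X L → IsOpen (Subtype.val ⁻¹' C : Set L))
    {x s : Fin n → ℝ} (hxX : x ∈ X) (hxC : x ∈ C) (hs : s ∈ X) :
    ∀ᶠ t in 𝓝[>] (0 : ℝ), AffineMap.homothety x t s ∈ C := by
  have hval : ∀ t : ℝ, AffineMap.homothety x t s = x + t • (s - x) := fun t => by
    simp [AffineMap.homothety_apply, add_comm]
  simp only [hval]
  by_cases hsx : s = x
  · simp [hsx, hxC]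
  obtain ⟨U, hU, hUC⟩ := isOpen_induced_iff.1 (hC _ ⟨x, s - x, sub_ne_zero.2 hsx, rfl⟩)
  have key : ∀ z, z ∈ X → (∃ t : ℝ, z = x + t • (s - x)) → (z ∈ U ↔ z ∈ C) :=
    fun z hz ht => Set.ext_iff.1 hUC ⟨z, hz, ht⟩
  have hxU : x ∈ U := (key x hxX ⟨0, by simp⟩).2 hxC
  have hcont : Continuous fun t : ℝ => x + t • (s - x) := by fun_prop
  have hev : ∀ᶠ t in 𝓝 (0 : ℝ), x + t • (s - x) ∈ U :=
    hcont.continuousAt (hU.mem_nhds (by simpa using hxU))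
  filter_upwards [hev.filter_mono nhdsWithin_le_nhds, Ioo_mem_nhdsGT (zero_lt_one (α := ℝ))]
    with t ht htI
  exact (key _ (hX.add_smul_sub_mem hxX hs ⟨htI.1.le, htI.2.le⟩) ⟨t, rfl⟩).1 ht

/-- A convex set that is relatively open on all lines contains a finite set whose convex hull is
a neighbourhood of a given point. -/
lemma exists_finite_subset_convexHull_mem_nhdsWithin {n : ℕ} {X C : Set (Fin n → ℝ)}
    (hX : Convex ℝ X) (hXB : PropertyB X)
    (hC : ∀ L, IsLineIn X L → IsOpen (Subtype.val ⁻¹' C : Set L))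
    {x : Fin n → ℝ} (hxX : x ∈ X) (hxC : x ∈ C) :
    ∃ S : Set (Fin n → ℝ), S.Finite ∧ S ⊆ C ∧ convexHull ℝ S ∈ 𝓝[X] x := by
  obtain ⟨S, hS, hSX, hSt⟩ := hXB.exists_finite_convexHull_homothety_mem_nhdsWithin hxX
  have hev : ∀ᶠ t in 𝓝[>] (0 : ℝ), ∀ s ∈ S, AffineMap.homothety x t s ∈ C :=
    (eventually_all_finite hS).2 fun s hs =>
      eventually_homothety_mem_of_isOpen_lines hX hC hxX hxC (hSX hs)
  obtain ⟨t, ht, htpos⟩ := (hev.and self_mem_nhdsWithin).exists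
  exact ⟨_, hS.image _, image_subset_iff.2 ht, hSt t htpos⟩

/-- Corollary 2: for `X ⊆ ℝⁿ` convex with property (B) and a correspondence `F`
from `X` into `X` with convex upper and lower sections, the graph of `F` is open in
`X × X` iff `F` has linearly open upper and lower sections. -/
theorem corollary2 {n : ℕ} {X : Set (Fin n → ℝ)}
    (hXconv : Convex ℝ X) (hXB : PropertyB X)
    (F : (Fin n → ℝ) → Set (Fin n → ℝ)) (hFX : ∀ x ∈ X, F x ⊆ X)
    (hup : ∀ x ∈ X, Convex ℝ (F x))
    (hlow : ∀ y ∈ X, Convex ℝ {x ∈ X | y ∈ F x}) :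
    IsOpen {p : X × X | (p.2 : Fin n → ℝ) ∈ F (p.1 : Fin n → ℝ)} ↔
      (∀ x ∈ X, ∀ L, IsLineIn X L → IsOpen (Subtype.val ⁻¹' F x : Set L)) ∧
        (∀ y ∈ X, ∀ L, IsLineIn X L →
          IsOpen (Subtype.val ⁻¹' {x | y ∈ F x} : Set L)) := by
  have hsub : ∀ {L}, IsLineIn X L → L ⊆ X := by
    rintro L ⟨p, v, -, rfl⟩
    exact inter_subset_left
  constructor
  · refine fun h => ⟨fun x hx L hL => ?_, fun y hy L hL => ?_⟩
    · exact h.preimage (f := fun z : L => ((⟨x, hx⟩, ⟨z, hsub hL z.2⟩) : X × X)) (by fun_prop)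
    · exact h.preimage (f := fun z : L => ((⟨z, hsub hL z.2⟩, ⟨y, hy⟩) : X × X)) (by fun_prop)
  · rintro ⟨hU, hL⟩
    rw [isOpen_iff_mem_nhds]
    rintro ⟨⟨x, hx⟩, ⟨y, hy⟩⟩ hxy
    replace hxy : y ∈ F x := hxy
    obtain ⟨S, hS, hSF, hSy⟩ :=
      exists_finite_subset_convexHull_mem_nhdsWithin hXconv hXB (hU x hx) hy hxy
    have hlower : ∀ s ∈ S, ∀ᶠ z in 𝓝[X] x, s ∈ F z := by
      intro s hs
      have hsX := hFX x hx (hSF hs)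
      have hopen : ∀ L, IsLineIn X L →
          IsOpen (Subtype.val ⁻¹' {z ∈ X | s ∈ F z} : Set L) := by
        intro L hLX
        convert hL s hsX L hLX using 1
        ext z
        simp [hsub hLX z.2]
      obtain ⟨T, -, hTF, hTx⟩ := exists_finite_subset_convexHull_mem_nhdsWithin hXconv hXB
        hopen hx ⟨hx, hSF hs⟩
      filter_upwards [hTx] with z hz
      exact (convexHull_min hTF (hlow s hsX) hz).2
    have hall : ∀ᶠ z in 𝓝[X] x, ∀ s ∈ S, s ∈ F z := (eventually_all_finite hS).2 hlower
    rw [nhdsWithin_eq_map_subtype_coe hx, eventually_map] at hall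
    rw [nhdsWithin_eq_map_subtype_coe hy, mem_map] at hSy
    rw [nhds_prod_eq]
    filter_upwards [prod_mem_prod hall hSy] with p hp
    exact convexHull_min hp.1 (hup _ p.1.2) hp.2
end

section
/- Let X be a topological space, let Z ⊆ ℝⁿ be a convex set satisfying property (B), and let G be a correspondence from X to Z such that G(x) is convex for every x ∈ X. Then G has open upper sections if and only if G has linearly open upper sections. -/
open Set

open Filter Topology in
/-- A set cut out by finitely many linear inequalities has finitely many extreme points. -/
theorem finite_extremePoints_setOf_forall_le {E J : Type*} [AddCommGroup E] [Module ℝ E]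
    [Finite J] (f : J → E →ₗ[ℝ] ℝ) (b : J → ℝ) :
    (Set.extremePoints ℝ {d | ∀ j, f j d ≤ b j}).Finite := by
  refine Set.Finite.of_finite_image (f := fun d => {j | f j d = b j}) (Set.toFinite _) ?_
  intro d hd e he hde
  have hactive : ∀ j, f j d = b j → f j e = b j := fun j hj => (Set.ext_iff.1 hde j).1 hj
  have hsmall : ∀ᶠ s : ℝ in 𝓝[>] 0, ∀ j,
      f j d + s * (f j d - f j e) ≤ b j ∧ f j d - s * (f j d - f j e) ≤ b j := by
    refine eventually_all.2 fun j => ?_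
    rcases (hd.1 j).eq_or_lt with hj | hj
    · refine Eventually.of_forall fun s => ?_
      rw [hj, hactive j hj]
      simp
    · have h₁ : ContinuousAt (fun s : ℝ => f j d + s * (f j d - f j e)) 0 := by fun_prop
      have h₂ : ContinuousAt (fun s : ℝ => f j d - s * (f j d - f j e)) 0 := by fun_prop
      refine Eventually.filter_mono nhdsWithin_le_nhds ?_
      filter_upwards [h₁.eventually_lt_const (u := b j) (by simpa using hj),
        h₂.eventually_lt_const (u := b j) (by simpa using hj)] with s hs₁ hs₂
      exact ⟨hs₁.le, hs₂.le⟩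
  obtain ⟨s, hs, hs0⟩ := (hsmall.and self_mem_nhdsWithin).exists
  have hs0 : 0 < s := hs0
  have hmem : d ∈ openSegment ℝ (d + s • (d - e)) (d - s • (d - e)) :=
    ⟨1 / 2, 1 / 2, by norm_num, by norm_num, by norm_num, by module⟩
  have heq := hd.2 (x₁ := d + s • (d - e)) (x₂ := d - s • (d - e))
    (fun j => by simpa using (hs j).1) (fun j => by simpa using (hs j).2) hmem
  have hzero : s • (d - e) = 0 := by simpa using heq
  exact sub_eq_zero.1 ((smul_eq_zero.1 hzero).resolve_left hs0.ne')

/-- A compact set cut out by finitely many continuous linear inequalities is the convex hull of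
finitely many of its points. -/
theorem exists_finite_convexHull_eq_of_isCompact_s5 {E J : Type*} [AddCommGroup E] [Module ℝ E]
    [TopologicalSpace E] [T2Space E] [IsTopologicalAddGroup E] [ContinuousSMul ℝ E]
    [LocallyConvexSpace ℝ E] [Finite J] (f : J → E →ₗ[ℝ] ℝ) (b : J → ℝ)
    (hcompact : IsCompact {d | ∀ j, f j d ≤ b j}) :
    ∃ S : Set E, S.Finite ∧ convexHull ℝ S = {d | ∀ j, f j d ≤ b j} := by
  have hfin := finite_extremePoints_setOf_forall_le f b
  have hconv : Convex ℝ {d | ∀ j, f j d ≤ b j} := by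
    rw [Set.ofPred_forall]
    exact convex_iInter fun j => convex_halfSpace_le (f j).isLinear (b j)
  refine ⟨_, hfin, ?_⟩
  rw [← (hfin.isClosed_convexHull ℝ).closure_eq]
  exact closure_convexHull_extremePoints hcompact hconv

/-- A set with property (B) coincides near each of its points with a polyhedral cone, which
contains the whole set. -/
theorem PropertyB.exists_cone {n : ℕ} {Z : Set (Fin n → ℝ)} (hZ : PropertyB Z)
    {x : Fin n → ℝ} (hx : x ∈ Z) :
    ∃ (m : ℕ) (f : Fin m → (Fin n → ℝ) →ₗ[ℝ] ℝ) (δ : ℝ), 0 < δ ∧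
      (∀ d, ‖d‖ ≤ δ → (∀ k, f k d ≤ 0) → x + d ∈ Z) ∧ ∀ d, x + d ∈ Z → ∀ k, f k d ≤ 0 := by
  rcases hZ with hopen | ⟨m, a, b, rfl⟩
  · obtain ⟨δ, hδ, hball⟩ := Metric.nhds_basis_closedBall.mem_iff.1 (hopen.mem_nhds hx)
    exact ⟨0, Fin.elim0, δ, hδ, fun d hd _ => hball (by simpa using hd), fun _ _ k => k.elim0⟩
  · classical
    let g : Fin m → (Fin n → ℝ) →ₗ[ℝ] ℝ := fun k => ∑ i, a k i • LinearMap.proj i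
    have hg : ∀ k z, ∑ i, a k i * z i = g k z := fun k z => by simp [g]
    simp only [hg, Set.mem_ofPred_eq] at hx ⊢
    have hinactive : ∀ᶠ d in nhds (0 : Fin n → ℝ), ∀ k, g k x < b k → g k (x + d) < b k := by
      refine Filter.eventually_all.2 fun k => ?_
      by_cases hk : g k x < b k
      · have hcont : Continuous fun d => g k (x + d) :=
          (g k).continuous_of_finiteDimensional.comp (continuous_const.add continuous_id)
        filter_upwards [hcont.continuousAt.eventually_lt_const (u := b k) (by simpa using hk)]
          with d hd _ using hd
      · exact Filter.Eventually.of_forall fun d h => absurd h hk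
    obtain ⟨δ, hδ, hball⟩ := Metric.nhds_basis_closedBall.eventually_iff.1 hinactive
    refine ⟨m, fun k => if g k x < b k then 0 else g k, δ, hδ, ?_, ?_⟩
    · intro d hd hcone k
      by_cases hk : g k x < b k
      · exact (hball (by simpa using hd) k hk).le
      · have := hcone k
        simp only [if_neg hk] at this
        rw [map_add]
        linarith [hx k]
    · intro d hd k
      by_cases hk : g k x < b k
      · simp [hk]
      · simp only [if_neg hk]
        have := hd k
        rw [map_add] at this
        linarith [hx k]

open Filter Topology in
/-- A set that is relatively open along lines contains, for each of its points `x` and each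
direction `d` pointing into `Z`, all points `x + s • d` with `s > 0` small. -/
theorem eventually_add_smul_mem_of_isOpen_line {n : ℕ} {Z C : Set (Fin n → ℝ)}
    (hZ : Convex ℝ Z) (hCZ : C ⊆ Z)
    (hC : ∀ L, IsLineIn Z L → IsOpen (Subtype.val ⁻¹' C : Set L))
    {x d : Fin n → ℝ} (hx : x ∈ C) (hd : x + d ∈ Z) :
    ∀ᶠ s : ℝ in 𝓝[>] 0, x + s • d ∈ C := by
  by_cases hd0 : d = 0
  · simp [hd0, hx]
  obtain ⟨U, hU, hUC⟩ := isOpen_induced_iff.1 (hC _ ⟨x, d, hd0, rfl⟩)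
  have hmem : ∀ s : ℝ, x + s • d ∈ Z → (x + s • d ∈ U ↔ x + s • d ∈ C) := fun s hs =>
    Set.ext_iff.1 hUC ⟨x + s • d, hs, s, rfl⟩
  have hxU : x + (0 : ℝ) • d ∈ U := (hmem 0 (by simpa using hCZ hx)).2 (by simpa using hx)
  have hcont : Continuous fun s : ℝ => x + s • d := by fun_prop
  have hevU : ∀ᶠ s : ℝ in 𝓝[>] 0, x + s • d ∈ U :=
    Eventually.filter_mono nhdsWithin_le_nhds
      (hcont.continuousAt.eventually_mem (hU.mem_nhds hxU))
  filter_upwards [hevU, Ioc_mem_nhdsGT (zero_lt_one' ℝ)] with s hsU hs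
  exact (hmem s (hZ.add_smul_mem (hCZ hx) hd ⟨hs.1.le, hs.2⟩)).1 hsU

/-- A convex subset of a convex set `Z` with property (B) is relatively open as soon as it is
relatively open along lines. -/
theorem isOpen_of_isOpen_line {n : ℕ} {Z C : Set (Fin n → ℝ)}
    (hZ : Convex ℝ Z) (hZB : PropertyB Z) (hCZ : C ⊆ Z) (hCconv : Convex ℝ C)
    (hC : ∀ L, IsLineIn Z L → IsOpen (Subtype.val ⁻¹' C : Set L)) :
    IsOpen (Subtype.val ⁻¹' C : Set Z) := by
  refine Metric.isOpen_iff.2 ?_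
  rintro ⟨x, hxZ⟩ hx
  have hx : x ∈ C := hx
  obtain ⟨m, f, δ, hδ, hsub, hsup⟩ := hZB.exists_cone hxZ
  let F : Fin m ⊕ Fin n ⊕ Fin n → (Fin n → ℝ) →ₗ[ℝ] ℝ :=
    Sum.elim f (Sum.elim (fun i => LinearMap.proj i) fun i => -LinearMap.proj i)
  let B : Fin m ⊕ Fin n ⊕ Fin n → ℝ := Sum.elim 0 fun _ => δ
  have hP : {d | ∀ j, F j d ≤ B j} = {d | (∀ k, f k d ≤ 0) ∧ ‖d‖ ≤ δ} := by
    ext d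
    simp only [F, B, Set.mem_ofPred_eq, Sum.forall, Sum.elim_inl, Sum.elim_inr, Pi.zero_apply,
      pi_norm_le_iff_of_nonneg hδ.le, Real.norm_eq_abs, abs_le, LinearMap.neg_apply,
      LinearMap.proj_apply, ← forall_and]
    refine and_congr_right fun _ => forall_congr' fun i => ?_
    constructor <;> rintro ⟨h₁, h₂⟩ <;> constructor <;> linarith
  have hcompact : IsCompact {d | ∀ j, F j d ≤ B j} := by
    refine Metric.isCompact_of_isClosed_isBounded ?_ ?_
    · rw [Set.ofPred_forall]
      exact isClosed_iInter fun j =>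
        isClosed_le (F j).continuous_of_finiteDimensional continuous_const
    · rw [hP]
      exact Metric.isBounded_closedBall.subset fun d hd => mem_closedBall_zero_iff.2 hd.2
  obtain ⟨S, hSfin, hS⟩ := exists_finite_convexHull_eq_of_isCompact_s5 F B hcompact
  rw [hP] at hS
  have hev : ∀ᶠ s : ℝ in nhdsWithin 0 (Set.Ioi 0), ∀ e ∈ S, x + s • e ∈ C := by
    refine (Filter.eventually_all_finite hSfin).2 fun e he => ?_
    have heP := hS.le (subset_convexHull ℝ S he)
    exact eventually_add_smul_mem_of_isOpen_line hZ hCZ hC hx (hsub e heP.2 heP.1)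
  obtain ⟨t, ht, ht0⟩ := (hev.and self_mem_nhdsWithin).exists
  have ht0 : 0 < t := ht0
  have hscaled : Convex ℝ {d | x + t • d ∈ C} :=
    (hCconv.translate_preimage_right x).smul_preimage t
  have hPC := convexHull_min ht hscaled
  rw [hS] at hPC
  refine ⟨t * δ, mul_pos ht0 hδ, fun ⟨z, hz⟩ hdist => ?_⟩
  have hdist : ‖z - x‖ < t * δ := by simpa [Subtype.dist_eq, dist_eq_norm] using hdist
  have hmem : t⁻¹ • (z - x) ∈ {d | x + t • d ∈ C} := by
    refine hPC ⟨fun k => ?_, ?_⟩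
    · rw [map_smul, smul_eq_mul]
      exact mul_nonpos_of_nonneg_of_nonpos (inv_nonneg.2 ht0.le) (hsup _ (by simpa using hz) k)
    · rw [norm_smul, norm_inv, Real.norm_of_nonneg ht0.le, inv_mul_le_iff₀ ht0]
      exact hdist.le
  simpa [smul_inv_smul₀ ht0.ne'] using hmem

/-- Proposition (b): for a correspondence `G` from a topological space `X` into a
convex set `Z ⊆ ℝⁿ` with property (B) whose upper sections are convex, `G` has open
upper sections iff it has linearly open upper sections. -/
theorem proposition_b {X : Type*} [TopologicalSpace X] {n : ℕ} {Z : Set (Fin n → ℝ)}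
    (hZconv : Convex ℝ Z) (hZB : PropertyB Z)
    (G : X → Set (Fin n → ℝ)) (hGZ : ∀ x, G x ⊆ Z)
    (hGconv : ∀ x, Convex ℝ (G x)) :
    (∀ x, IsOpen (Subtype.val ⁻¹' G x : Set Z)) ↔
      (∀ x, ∀ L, IsLineIn Z L → IsOpen (Subtype.val ⁻¹' G x : Set L)) := by
  refine ⟨fun h x L hL => ?_, fun h x =>
    isOpen_of_isOpen_line hZconv hZB (hGZ x) (hGconv x) (h x)⟩
  obtain ⟨p, v, -, rfl⟩ := hL
  exact (h x).preimage (continuous_inclusion Set.inter_subset_left)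
end

section
/- Let X = ℝⁿ₊ = {x ∈ ℝⁿ : xᵢ ≥ 0 for all i}, and let P be a correspondence from X to X such that either P(x) is convex for every x ∈ X, or P⁻¹(y) is convex for every y ∈ X. Then the graph of P is open in X × X if and only if P has open upper sections and open lower sections. -/
open Set

/-- A closed box is the convex hull of its vertices. -/
theorem convexHull_pi_pair {ι : Type*} [Finite ι] {l u : ι → ℝ} (h : ∀ i, l i ≤ u i) :
    convexHull ℝ (univ.pi fun i => {l i, u i}) = univ.pi fun i => Icc (l i) (u i) := by
  rw [convexHull_pi]
  congr! 2 with i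
  rw [convexHull_pair, segment_eq_Icc (h i)]

/-- In the nonnegative orthant, every relatively open neighbourhood of a point contains finitely
many points whose convex hull is again a relative neighbourhood of that point. -/
theorem exists_finite_orthant_convexHull_nhds {ι : Type*} [Fintype ι] {U : Set (ι → ℝ)}
    {y : ι → ℝ} (hU : U ∈ nhdsWithin y (Ici 0)) :
    ∃ F : Set (ι → ℝ), F.Finite ∧ F ⊆ U ∩ Ici 0 ∧
      convexHull ℝ F ∈ nhdsWithin y (Ici 0) := by
  obtain ⟨ε, hε, hball⟩ := Metric.mem_nhdsWithin_iff.1 hU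
  by_cases hy : 0 ≤ y
  · have hy' : ∀ i, 0 ≤ y i := hy
    have hlu : ∀ i, max 0 (y i - ε / 2) ≤ y i + ε / 2 := fun i =>
      max_le (by linarith [hy' i]) (by linarith)
    refine ⟨univ.pi fun i => {max 0 (y i - ε / 2), y i + ε / 2},
      Finite.pi fun i => toFinite _, fun v hv => ?_, ?_⟩
    · have hv0 : (0 : ι → ℝ) ≤ v := fun i => by
        rcases hv i (mem_univ i) with h | h <;> rw [h]
        · exact le_max_left _ _
        · exact (le_max_left _ _).trans (hlu i)
      refine ⟨hball ⟨?_, hv0⟩, hv0⟩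
      refine ((dist_pi_le_iff (half_pos hε).le).2 fun i => ?_).trans_lt (half_lt_self hε)
      rw [Real.dist_eq, abs_sub_le_iff]
      rcases hv i (mem_univ i) with h | h <;> rw [h]
      · exact ⟨by linarith [max_le (hy' i) (by linarith : y i - ε / 2 ≤ y i)],
          by linarith [le_max_right 0 (y i - ε / 2)]⟩
      · constructor <;> linarith
    · rw [convexHull_pi_pair hlu]
      refine Metric.mem_nhdsWithin_iff.2 ⟨ε / 2, half_pos hε, fun z hz i _ => ?_⟩
      have hd := (dist_le_pi_dist z y i).trans hz.1.le
      rw [Real.dist_eq, abs_sub_le_iff] at hd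
      exact ⟨max_le (hz.2 i) (by linarith), by linarith⟩
  · refine ⟨∅, finite_empty, empty_subset _, ?_⟩
    have : nhdsWithin y (Ici (0 : ι → ℝ)) = ⊥ := by
      rw [← notMem_closure_iff_nhdsWithin_eq_bot, isClosed_Ici.closure_eq]
      exact hy
    simp [this]

/-- A correspondence into the nonnegative orthant with convex, relatively open upper sections and
open lower sections has an open graph. -/
theorem isOpen_graph_of_convex_sections {ι α : Type*} [Fintype ι] [TopologicalSpace α]
    {S : α → Set (ι → ℝ)} (hconv : ∀ a, Convex ℝ (S a))
    (hupper : ∀ a, IsOpen (Subtype.val ⁻¹' S a : Set (Ici (0 : ι → ℝ))))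
    (hlower : ∀ y ∈ Ici (0 : ι → ℝ), IsOpen {a | y ∈ S a}) :
    IsOpen {p : α × Ici (0 : ι → ℝ) | (p.2 : ι → ℝ) ∈ S p.1} := by
  refine isOpen_iff_mem_nhds.2 fun ⟨a, y⟩ hay => ?_
  obtain ⟨F, hF, hFS, hFy⟩ := exists_finite_orthant_convexHull_nhds
    (mem_nhdsWithin_iff_exists_mem_nhds_inter.2
      (by
        obtain ⟨V, hV, hVS⟩ := mem_nhds_subtype _ y _ |>.1 ((hupper a).mem_nhds hay)
        exact ⟨V, hV, fun z hz => @hVS ⟨z, hz.2⟩ hz.1⟩) : S a ∈ nhdsWithin y.1 (Ici 0))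
  have hA : {b | ∀ v ∈ F, v ∈ S b} ∈ nhds a :=
    (Filter.eventually_all_finite hF).2 fun v hv =>
      (hlower v (hFS hv).2).mem_nhds (hFS hv).1
  have hB : (Subtype.val ⁻¹' convexHull ℝ F : Set (Ici (0 : ι → ℝ))) ∈ nhds y :=
    preimage_coe_mem_nhds_subtype.2 hFy
  filter_upwards [prod_mem_nhds hA hB] with p hp
  exact convexHull_min hp.1 (hconv p.1) hp.2

/-- Corollary (Shafer): let `X = ℝⁿ₊` and `P` a correspondence from `X` into `X`
such that either all upper sections `P(x)` are convex or all lower sections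
`P⁻¹(y)` are convex. Then the graph of `P` is open in `X × X` iff `P` has open
upper and lower sections. -/
theorem corollary_shafer {n : ℕ}
    (X : Set (Fin n → ℝ)) (hX : X = {z : Fin n → ℝ | ∀ i, 0 ≤ z i})
    (P : (Fin n → ℝ) → Set (Fin n → ℝ)) (hPX : ∀ x ∈ X, P x ⊆ X)
    (hconv : (∀ x ∈ X, Convex ℝ (P x)) ∨ (∀ y ∈ X, Convex ℝ {x ∈ X | y ∈ P x})) :
    IsOpen {p : X × X | (p.2 : Fin n → ℝ) ∈ P (p.1 : Fin n → ℝ)} ↔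
      (∀ x ∈ X, IsOpen (Subtype.val ⁻¹' P x : Set X)) ∧
        (∀ y ∈ X, IsOpen (Subtype.val ⁻¹' {x | y ∈ P x} : Set X)) := by
  obtain rfl : X = Ici 0 := hX
  constructor
  · intro h
    exact ⟨fun x hx => h.preimage (Continuous.prodMk_right (⟨x, hx⟩ : Ici (0 : Fin n → ℝ))),
      fun y hy => h.preimage (Continuous.prodMk_left (⟨y, hy⟩ : Ici (0 : Fin n → ℝ)))⟩
  · rintro ⟨hupper, hlower⟩
    rcases hconv with hc | hc
    · exact isOpen_graph_of_convex_sections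
        (S := fun x : Ici (0 : Fin n → ℝ) => P x) (fun x => hc x x.2) (fun x => hupper x x.2) hlower
    · have h := isOpen_graph_of_convex_sections
        (S := fun y : Ici (0 : Fin n → ℝ) => {x ∈ Ici (0 : Fin n → ℝ) | (y : Fin n → ℝ) ∈ P x})
        (fun y => hc y y.2)
        (fun y => by
          convert hlower y y.2 using 1
          ext x
          exact and_iff_right x.2)
        (fun x hx => by
          convert hupper x hx using 1
          ext y
          exact and_iff_right hx)
      convert h.preimage continuous_swap using 1
      ext p
      exact (and_iff_right p.1.2).symm
end

section
/- Let X = ℝⁿ₊ = {x ∈ ℝⁿ : xᵢ ≥ 0 for all i}, and let P be a binary relation on X (viewed as a correspondence x ↦ P(x) with y ∈ P(x) meaning y is strictly preferred to x) that is transitive (z ∈ P(y) and y ∈ P(x) imply z ∈ P(x)), irreflexive (x ∉ P(x) for all x), and strongly monotone (for all x,y ∈ X, if xᵢ ≥ yᵢ for all i and x ≠ y, then x ∈ P(y)). Then the graph of P is open in X × X if and only if P has open upper sections and open lower sections. -/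
open Set
open scoped Topology

/-- Corollary (Schmeidler): let `X = ℝⁿ₊` and `P` a binary relation on `X` (viewed
as a correspondence, `y ∈ P x` meaning `y` is strictly preferred to `x`) that is
transitive, irreflexive and strongly monotone. Then the graph of `P` is open in
`X × X` iff `P` has open upper and lower sections. -/
theorem corollary_schmeidler {n : ℕ}
    (X : Set (Fin n → ℝ)) (hX : X = {z : Fin n → ℝ | ∀ i, 0 ≤ z i})
    (P : (Fin n → ℝ) → Set (Fin n → ℝ)) (hPX : ∀ x ∈ X, P x ⊆ X)
    (htrans : ∀ x ∈ X, ∀ y ∈ X, ∀ z ∈ X, z ∈ P y → y ∈ P x → z ∈ P x)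
    (hirr : ∀ x ∈ X, x ∉ P x)
    (hmono : ∀ x ∈ X, ∀ y ∈ X, (∀ i, y i ≤ x i) → x ≠ y → x ∈ P y) :
    IsOpen {p : X × X | (p.2 : Fin n → ℝ) ∈ P (p.1 : Fin n → ℝ)} ↔
      (∀ x ∈ X, IsOpen (Subtype.val ⁻¹' P x : Set X)) ∧
        (∀ y ∈ X, IsOpen (Subtype.val ⁻¹' {x | y ∈ P x} : Set X)) := by
  have hX_iff : ∀ z, z ∈ X ↔ ∀ i, 0 ≤ z i := fun z => by rw [hX]; rfl
  constructor
  · intro h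
    refine ⟨fun x hx => ?_, fun y hy => ?_⟩
    · exact h.preimage (f := fun y : X => ((⟨x, hx⟩ : X), y)) (by fun_prop)
    · exact h.preimage (f := fun x : X => (x, (⟨y, hy⟩ : X))) (by fun_prop)
  · rintro ⟨hupper, hlower⟩
    rw [isOpen_iff_mem_nhds]
    rintro ⟨⟨x, hx⟩, ⟨y, hy⟩⟩ hxy
    let f : ℝ → X := fun t =>
      ⟨fun i => x i + |t|, (hX_iff _).2 fun i => add_nonneg ((hX_iff x).1 hx i) (abs_nonneg t)⟩
    have hf : Continuous f := by
      refine Continuous.subtype_mk ?_ _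
      fun_prop
    have hf_zero : f 0 = ⟨x, hx⟩ := Subtype.ext (by simp [f])
    have hnear : ∀ᶠ t in 𝓝[>] (0 : ℝ), y ∈ P (f t) := by
      refine nhdsWithin_le_nhds (((hlower y hy).preimage hf).mem_nhds ?_)
      simpa [hf_zero] using hxy
    obtain ⟨ε, hyε, hε⟩ := (hnear.and self_mem_nhdsWithin).exists
    have hε : 0 < ε := hε
    have hU : IsOpen {u : X | ∀ i, (u : Fin n → ℝ) i < (f ε : Fin n → ℝ) i} := by
      simp only [ofPred_forall]
      exact isOpen_iInter_of_finite fun i =>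
        isOpen_lt ((continuous_apply i).comp continuous_subtype_val) continuous_const
    refine Filter.mem_of_superset
      ((hU.prod (hupper (f ε) (f ε).2)).mem_nhds ⟨fun i => ?_, hyε⟩) ?_
    · simpa [f] using hε.ne'
    · rintro ⟨u, v⟩ ⟨hu, hv⟩
      by_cases hne : (f ε : Fin n → ℝ) = u
      · simpa [hne] using hv
      · exact htrans u u.2 (f ε) (f ε).2 v v.2 hv
          (hmono (f ε) (f ε).2 u u.2 (fun i => (hu i).le) hne)
end

section
/- Let X = ∏ᵢ₌₁ⁿ Yᵢ ⊆ ℝⁿ be a product of sets Yᵢ ⊆ ℝ and let ≿ be a complete and transitive binary relation on X. Then ≿ is separately monotone if and only if ≿ is monotone. -/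
open Set

/-- `R` is separately monotone and increasing in each coordinate on `X`. -/
def SepMonotoneInc {n : ℕ} (X : Set (Fin n → ℝ))
    (R : (Fin n → ℝ) → (Fin n → ℝ) → Prop) : Prop :=
  ∀ (i : Fin n) (z : Fin n → ℝ) (a b : ℝ),
    Function.update z i a ∈ X → Function.update z i b ∈ X → b < a →
      R (Function.update z i a) (Function.update z i b)

/-- `R` is separately monotone on `X`. -/
def SepMonotoneRel {n : ℕ} (X : Set (Fin n → ℝ))
    (R : (Fin n → ℝ) → (Fin n → ℝ) → Prop) : Prop :=
  SepMonotoneInc X R ∨ SepMonotoneInc X (fun x y => R y x)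

/-- `R` is monotone on `X`:  `x > y` (componentwise `≥` and `x ≠ y`) implies
`x ≿ y` for all `x, y`, or `x > y` implies `x ≾ y` for all `x, y`. -/
def MonotoneRel {n : ℕ} (X : Set (Fin n → ℝ))
    (R : (Fin n → ℝ) → (Fin n → ℝ) → Prop) : Prop :=
  (∀ x ∈ X, ∀ y ∈ X, (∀ i, y i ≤ x i) → x ≠ y → R x y) ∨
    (∀ x ∈ X, ∀ y ∈ X, (∀ i, y i ≤ x i) → x ≠ y → R y x)

/-- On a product set, a reflexive and transitive relation that is increasing in each coordinate
is increasing for the componentwise order. -/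
theorem SepMonotoneInc.rel_of_le {n : ℕ} {Y : Fin n → Set ℝ}
    {R : (Fin n → ℝ) → (Fin n → ℝ) → Prop} (h : SepMonotoneInc (univ.pi Y) R)
    (hrefl : ∀ x ∈ univ.pi Y, R x x)
    (htrans : ∀ x ∈ univ.pi Y, ∀ y ∈ univ.pi Y, ∀ z ∈ univ.pi Y, R x y → R y z → R x z)
    {x y : Fin n → ℝ} (hx : x ∈ univ.pi Y) (hy : y ∈ univ.pi Y) (hyx : y ≤ x) : R x y := by
  have hmem (s : Finset (Fin n)) : s.piecewise x y ∈ univ.pi Y := fun i _ => by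
    by_cases hi : i ∈ s
    · simpa [hi] using hx i trivial
    · simpa [hi] using hy i trivial
  have key (s : Finset (Fin n)) : R (s.piecewise x y) y := by
    induction s using Finset.induction_on with
    | empty => simpa using hrefl y hy
    | insert j s hj ih =>
      refine htrans _ (hmem _) _ (hmem s) _ hy ?_ ih
      have hself : Function.update (s.piecewise x y) j (y j) = s.piecewise x y := by
        rw [Function.update_eq_self_iff, Finset.piecewise_eq_of_notMem _ _ _ hj]
      have hins := Finset.piecewise_insert s x y j
      rcases (hyx j).lt_or_eq with hlt | heq
      · have hstep := h j (s.piecewise x y) (x j) (y j) (hins ▸ hmem _)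
          (hself.symm ▸ hmem s) hlt
        rwa [hself, ← hins] at hstep
      · rw [hins, ← heq, hself]
        exact hrefl _ (hmem s)
  simpa using key Finset.univ

/-- A relation that is increasing for the componentwise order is increasing in each coordinate. -/
theorem sepMonotoneInc_of_rel_of_le {n : ℕ} {X : Set (Fin n → ℝ)}
    {R : (Fin n → ℝ) → (Fin n → ℝ) → Prop}
    (h : ∀ x ∈ X, ∀ y ∈ X, (∀ i, y i ≤ x i) → x ≠ y → R x y) : SepMonotoneInc X R :=
  fun i z _ _ ha hb hba => h _ ha _ hb (update_le_update_iff'.2 hba.le)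
    fun he => hba.ne' (Function.update_injective z i he)

/-- A complete and transitive binary relation on a product set `X = ∏ᵢ Yᵢ ⊆ ℝⁿ` is
separately monotone if and only if it is monotone. -/
theorem sepMonotone_iff_monotone {n : ℕ} {X : Set (Fin n → ℝ)}
    (Yi : Fin n → Set ℝ) (hX : X = Set.univ.pi Yi)
    (R : (Fin n → ℝ) → (Fin n → ℝ) → Prop)
    (hcomp : ∀ x ∈ X, ∀ y ∈ X, R x y ∨ R y x)
    (htrans : ∀ x ∈ X, ∀ y ∈ X, ∀ z ∈ X, R x y → R y z → R x z) :
    SepMonotoneRel X R ↔ MonotoneRel X R := by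
  subst hX
  have hrefl : ∀ x ∈ univ.pi Yi, R x x := fun x hx => (hcomp x hx x hx).elim id id
  constructor
  · rintro (h | h)
    · exact .inl fun x hx y hy hyx _ => h.rel_of_le hrefl htrans hx hy hyx
    · exact .inr fun x hx y hy hyx _ => h.rel_of_le hrefl
        (fun a ha b hb c hc hab hbc => htrans c hc b hb a ha hbc hab) hx hy hyx
  · exact Or.imp sepMonotoneInc_of_rel_of_le sepMonotoneInc_of_rel_of_le
end

section
/- Let X = {x ∈ [0,1]² : x₂ ≥ x₁} with the subspace topology from ℝ², and let A = {x ∈ [0,1]² : x₂ > x₁} ∪ {(1,1)} ⊆ X. Then for every straight line L in X parallel to a coordinate axis, A ∩ L is convex and open in the subspace topology of L; nevertheless, A is not open in X (the point (1,1) ∈ A is not an interior point of A relative to X). -/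
open Set

/-- The triangle `X = {x ∈ [0,1]² : x₂ ≥ x₁}`. -/
def Xtri : Set (Fin 2 → ℝ) :=
  {x | x 0 ∈ Set.Icc (0 : ℝ) 1 ∧ x 1 ∈ Set.Icc (0 : ℝ) 1 ∧ x 0 ≤ x 1}

/-- The set `A = {x ∈ [0,1]² : x₂ > x₁} ∪ {(1,1)}`. -/
def Atri : Set (Fin 2 → ℝ) :=
  {x | x 0 ∈ Set.Icc (0 : ℝ) 1 ∧ x 1 ∈ Set.Icc (0 : ℝ) 1 ∧ x 0 < x 1} ∪ {![1, 1]}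

theorem mem_Atri_iff {x : Fin 2 → ℝ} (hx : x ∈ Xtri) :
    x ∈ Atri ↔ x 0 < x 1 ∨ x 0 = 1 := by
  obtain ⟨h0, h1, h⟩ := hx
  constructor
  · rintro (hA | rfl)
    · exact Or.inl hA.2.2
    · exact Or.inr rfl
  · rintro (hlt | h01)
    · exact Or.inl ⟨h0, h1, hlt⟩
    · refine Or.inr ?_
      have h11 : x 1 = 1 := le_antisymm h1.2 (h01 ▸ h)
      ext j
      fin_cases j
      · exact h01
      · exact h11

theorem convex_Xtri : Convex ℝ Xtri := by
  rintro x ⟨hx0, hx1, hx⟩ y ⟨hy0, hy1, hy⟩ a b ha hb hab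
  refine ⟨convex_Icc 0 1 hx0 hy0 ha hb hab, convex_Icc 0 1 hx1 hy1 ha hb hab, ?_⟩
  simp only [Pi.add_apply, Pi.smul_apply, smul_eq_mul]
  gcongr

theorem IsAxisLineIn.convex {n : ℕ} {Y L : Set (Fin n → ℝ)} (hY : Convex ℝ Y)
    (hL : IsAxisLineIn Y L) : Convex ℝ L := by
  obtain ⟨p, i, rfl⟩ := hL
  refine hY.inter ?_
  rintro x ⟨s, rfl⟩ y ⟨t, rfl⟩ a b - - hab
  refine ⟨a * s + b * t, ?_⟩
  obtain rfl : b = 1 - a := by linarith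
  module

theorem convex_setOf_apply_lt : Convex ℝ {x : Fin 2 → ℝ | x 0 < x 1} := by
  have h : IsLinearMap ℝ fun x : Fin 2 → ℝ => x 0 - x 1 :=
    ⟨fun x y => by simp only [Pi.add_apply]; ring,
      fun c x => by simp only [Pi.smul_apply, smul_eq_mul]; ring⟩
  simpa only [sub_neg] using convex_halfSpace_lt h 0

/-- An axis-parallel line in the triangle lies inside `Atri`, or meets it exactly in the
points strictly above the diagonal. -/
theorem IsAxisLineIn.subset_Atri_or {L : Set (Fin 2 → ℝ)} (hL : IsAxisLineIn Xtri L) :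
    L ⊆ Atri ∨ ∀ x ∈ L, (x ∈ Atri ↔ x 0 < x 1) := by
  obtain ⟨p, i, rfl⟩ := hL
  by_cases hp : p (1 - i) = 1
  · left
    rintro x ⟨hx, t, rfl⟩
    rw [mem_Atri_iff hx]
    obtain ⟨h0, h1, h⟩ := hx
    fin_cases i <;> simp_all
    exact or_comm.1 h0.2.eq_or_lt
  · right
    rintro x ⟨hx, t, rfl⟩
    rw [mem_Atri_iff hx, or_iff_left_iff_imp]
    intro h01
    obtain ⟨h0, h1, h⟩ := hx
    fin_cases i <;> simp_all
    exact absurd (le_antisymm h1.2 h) hp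

theorem Atri_notMem_nhdsWithin : Atri ∉ nhdsWithin ![1, 1] Xtri := by
  intro hA
  have hc : Continuous fun t : ℝ => (![t, t] : Fin 2 → ℝ) := by fun_prop
  have hIco : Ico (0 : ℝ) 1 ∈ nhdsWithin (1 : ℝ) (Iio 1) := Ico_mem_nhdsLT one_pos
  have ht : Filter.Tendsto (fun t : ℝ => (![t, t] : Fin 2 → ℝ)) (nhdsWithin 1 (Iio 1))
      (nhdsWithin ![1, 1] Xtri) := by
    refine tendsto_nhdsWithin_iff.2 ⟨hc.continuousAt.tendsto.mono_left nhdsWithin_le_nhds, ?_⟩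
    filter_upwards [hIco] with t ht
    exact ⟨Ico_subset_Icc_self ht, Ico_subset_Icc_self ht, le_rfl⟩
  obtain ⟨t, htA, ht⟩ := ((ht.eventually hA).and hIco).exists
  rcases (mem_Atri_iff ⟨Ico_subset_Icc_self ht, Ico_subset_Icc_self ht, le_rfl⟩).1 htA with h | h
  · exact lt_irrefl t h
  · exact ht.2.ne h

/-- Example 1: `A ∩ L` is convex and open in `L` for every axis-parallel straight
line `L` in `X`, yet `A` is not open in `X`: the point `(1,1) ∈ A` is not an
interior point of `A` relative to `X`. -/
theorem example1 :
    (∀ L, IsAxisLineIn Xtri L →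
      Convex ℝ (Atri ∩ L) ∧ IsOpen (Subtype.val ⁻¹' Atri : Set L)) ∧
    ¬ IsOpen (Subtype.val ⁻¹' Atri : Set Xtri) ∧
    ∀ p : Xtri, (p : Fin 2 → ℝ) = ![1, 1] →
      p ∈ (Subtype.val ⁻¹' Atri : Set Xtri) ∧
        p ∉ interior (Subtype.val ⁻¹' Atri : Set Xtri) := by
  have hint : ∀ p : Xtri, (p : Fin 2 → ℝ) = ![1, 1] →
      p ∈ (Subtype.val ⁻¹' Atri : Set Xtri) ∧
        p ∉ interior (Subtype.val ⁻¹' Atri : Set Xtri) := by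
    intro p hp
    refine ⟨Or.inr hp, fun h => Atri_notMem_nhdsWithin ?_⟩
    rwa [mem_interior_iff_mem_nhds, preimage_coe_mem_nhds_subtype, hp] at h
  refine ⟨fun L hL => ?_, fun hopen => ?_, hint⟩
  · have hconv := hL.convex convex_Xtri
    rcases hL.subset_Atri_or with h | h
    · rw [inter_eq_self_of_subset_right h, preimage_eq_univ_iff.2 (Subtype.range_coe.trans_subset h)]
      exact ⟨hconv, isOpen_univ⟩
    · have hA : Atri ∩ L = {x | x 0 < x 1} ∩ L := by
        ext x
        exact and_congr_left (h x)
      have hpre : (Subtype.val ⁻¹' Atri : Set L) = {x | x.1 0 < x.1 1} := by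
        ext x
        exact h x x.2
      rw [hA, hpre]
      exact ⟨convex_setOf_apply_lt.inter hconv, isOpen_lt
        ((continuous_apply 0).comp continuous_subtype_val)
        ((continuous_apply 1).comp continuous_subtype_val)⟩
  · have hmem : (![1, 1] : Fin 2 → ℝ) ∈ Xtri := by simp [Xtri]
    obtain ⟨hp, hp'⟩ := hint ⟨_, hmem⟩ rfl
    exact hp' (hopen.interior_eq.symm ▸ hp)
end

section
/- Let X = [0,1] with the subspace topology from ℝ, and define a correspondence F from X to X by F(0) = (0,1] and, for x ∈ (0,1], F(x) = {y ∈ [0,1] : y > x and y ≠ 1 − x}. Then F(x) is open in X for every x ∈ X and F⁻¹(y) = {x ∈ X : y ∈ F(x)} is open in X for every y ∈ X, but the graph gr F = {(x,y) ∈ X × X : y ∈ F(x)} is not open in X × X (the point (0,1) ∈ gr F is not an interior point of gr F). -/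
open Set

/-- The unit interval `X = [0,1] ⊆ ℝ`. -/
def XI : Set ℝ := Set.Icc 0 1

/-- The correspondence with `F 0 = (0,1]` and
`F x = {y ∈ [0,1] : y > x, y ≠ 1 - x}` for `x ∈ (0,1]`. -/
noncomputable def Fex : ℝ → Set ℝ := fun x =>
  if x = 0 then Set.Ioc 0 1 else {y | y ∈ Set.Icc (0 : ℝ) 1 ∧ x < y ∧ y ≠ 1 - x}

theorem mem_Fex_iff {x y : ℝ} (hy : y ∈ XI) :
    y ∈ Fex x ↔ x < y ∧ (x = 0 ∨ y ≠ 1 - x) := by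
  obtain ⟨hy0, hy1⟩ := hy
  by_cases h : x = 0
  · simp [Fex, h, hy1]
  · simp [Fex, h, hy0, hy1]

theorem isOpen_upper_section (x : XI) : IsOpen (Subtype.val ⁻¹' Fex x : Set XI) := by
  have h : (Subtype.val ⁻¹' Fex x : Set XI) =
      {y : XI | (x : ℝ) < y} ∩ {y : XI | (x : ℝ) = 0 ∨ (y : ℝ) ≠ 1 - x} := by
    ext y
    exact mem_Fex_iff y.2
  rw [h]
  refine (isOpen_lt continuous_const continuous_subtype_val).inter ?_
  by_cases hx : (x : ℝ) = 0
  · simp [hx]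
  · simpa [hx] using isOpen_ne_fun continuous_subtype_val continuous_const

theorem isOpen_lower_section (y : XI) : IsOpen {x : XI | (y : ℝ) ∈ Fex x} := by
  have h : {x : XI | (y : ℝ) ∈ Fex x} =
      {x : XI | (x : ℝ) < y} ∩ {x : XI | (y : ℝ) = 1 ∨ (y : ℝ) ≠ 1 - x} := by
    ext x
    simp only [mem_ofPred_eq, mem_inter_iff, mem_Fex_iff y.2]
    grind
  rw [h]
  refine (isOpen_lt continuous_subtype_val continuous_const).inter ?_
  by_cases hy : (y : ℝ) = 1
  · simp [hy]
  · simpa [hy] using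
      isOpen_ne_fun continuous_const (continuous_const.sub continuous_subtype_val)

theorem mem_graph_of_eq_zero_of_eq_one {p : XI × XI} (h0 : (p.1 : ℝ) = 0) (h1 : (p.2 : ℝ) = 1) :
    p ∈ {q : XI × XI | (q.2 : ℝ) ∈ Fex (q.1 : ℝ)} := by
  simp [Fex, h0, h1]

theorem notMem_interior_graph {p : XI × XI} (h0 : (p.1 : ℝ) = 0) (h1 : (p.2 : ℝ) = 1) :
    p ∉ interior {q : XI × XI | (q.2 : ℝ) ∈ Fex (q.1 : ℝ)} := by
  intro hp
  -- Approach `(0, 1)` along the antidiagonal `t ↦ (t, 1 - t)`.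
  let γ : XI → XI × XI := fun t => (t, ⟨1 - t, by linarith [t.2.2], by linarith [t.2.1]⟩)
  have hγ : Continuous γ := by fun_prop
  have hγp : γ p.1 = p := by
    ext <;> simp [γ, h0, h1]
  obtain ⟨ε, hε, hball⟩ := Metric.isOpen_iff.1 (isOpen_interior.preimage hγ) p.1
    (by rwa [mem_preimage, hγp])
  have ht : 0 < min (ε / 2) 1 := by positivity
  let t : XI := ⟨min (ε / 2) 1, ht.le, min_le_right _ _⟩
  have htb : t ∈ Metric.ball p.1 ε := by
    rw [Metric.mem_ball, Subtype.dist_eq, Real.dist_eq, h0, sub_zero, abs_of_pos ht]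
    exact (min_le_left _ _).trans_lt (half_lt_self hε)
  have hmem : γ t ∈ {q : XI × XI | (q.2 : ℝ) ∈ Fex (q.1 : ℝ)} := interior_subset (hball htb)
  rcases ((mem_Fex_iff (γ t).2.2).1 hmem).2 with h | h
  · exact ht.ne' h
  · exact h rfl

/-- Example 4: `F` has open upper and lower sections in `X = [0,1]`, but its graph
is not open in `X × X`: the point `(0,1)` of the graph is not an interior point. -/
theorem example4 :
    (∀ x : XI, IsOpen (Subtype.val ⁻¹' Fex x : Set XI)) ∧
    (∀ y : XI, IsOpen {x : XI | (y : ℝ) ∈ Fex x}) ∧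
    ¬ IsOpen {p : XI × XI | (p.2 : ℝ) ∈ Fex (p.1 : ℝ)} ∧
    ∀ p : XI × XI, (p.1 : ℝ) = 0 → (p.2 : ℝ) = 1 →
      p ∈ {q : XI × XI | (q.2 : ℝ) ∈ Fex (q.1 : ℝ)} ∧
        p ∉ interior {q : XI × XI | (q.2 : ℝ) ∈ Fex (q.1 : ℝ)} := by
  refine ⟨isOpen_upper_section, isOpen_lower_section, fun h => ?_, fun p h0 h1 =>
    ⟨mem_graph_of_eq_zero_of_eq_one h0 h1, notMem_interior_graph h0 h1⟩⟩
  let p : XI × XI := (⟨0, le_rfl, zero_le_one⟩, ⟨1, zero_le_one, le_rfl⟩)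
  refine notMem_interior_graph (p := p) rfl rfl ?_
  rw [h.interior_eq]
  exact mem_graph_of_eq_zero_of_eq_one rfl rfl
end

section
/- Define f : ℝ² → ℝ by f(x₁,x₂) = 2x₁x₂/(x₁² + x₂²) + min{x₁,x₂} if x₁ ≥ 0, x₂ ≥ 0 and (x₁,x₂) ≠ (0,0), and f(x) = 0 otherwise. Then: (i) for every straight line L in ℝ² parallel to a coordinate axis, the restriction of f to L is continuous; consequently, the binary relation ≿ on ℝ² defined by x ≿ y iff f(x) ≥ f(y) is separately continuous (for every x, the sets A≿(x) ∩ L and A≾(x) ∩ L are closed in L for every axis-parallel straight line L); (ii) nevertheless, ≿ is not upper mixture continuous: the set {λ ∈ [0,1] : λ(1,1) + (1−λ)(0,0) ≿ (1, 1/4)} equals (0,1], which is not closed in [0,1] (indeed f(λ,λ) = 1 + λ for λ > 0 while f(0,0) = 0, and f(1,1/4) = 49/68). -/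
open Set

/-- The function `f(x₁,x₂) = 2x₁x₂/(x₁²+x₂²) + min{x₁,x₂}` on `ℝ²₊ \ {0}`, and
`f = 0` otherwise. -/
noncomputable def fgp : (Fin 2 → ℝ) → ℝ := fun x =>
  if 0 ≤ x 0 ∧ 0 ≤ x 1 ∧ x ≠ 0 then
    2 * x 0 * x 1 / ((x 0) ^ 2 + (x 1) ^ 2) + min (x 0) (x 1)
  else 0

/-- The formula defining `fgp`, read with truncated coordinates, is valid on the whole plane. -/
theorem fgp_eq_posPart (x : Fin 2 → ℝ) :
    fgp x = 2 * max (x 0) 0 * max (x 1) 0 / ((max (x 0) 0) ^ 2 + (max (x 1) 0) ^ 2)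
      + min (max (x 0) 0) (max (x 1) 0) := by
  unfold fgp
  split_ifs with h
  · rw [max_eq_left h.1, max_eq_left h.2.1]
  · rcases lt_or_ge (x 0) 0 with h0 | h0
    · simp [max_eq_right h0.le]
    rcases lt_or_ge (x 1) 0 with h1 | h1
    · simp [max_eq_right h1.le]
    have hx : x = 0 := by
      by_contra hx
      exact h ⟨h0, h1, hx⟩
    simp [hx]

theorem fgp_swap (a b : ℝ) : fgp ![a, b] = fgp ![b, a] := by
  simp only [fgp_eq_posPart, Matrix.cons_val_zero, Matrix.cons_val_one]
  rw [min_comm, add_comm ((max a 0) ^ 2), mul_right_comm]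

theorem continuous_fgp_left (c : ℝ) : Continuous fun t : ℝ => fgp ![t, c] := by
  simp only [fgp_eq_posPart, Matrix.cons_val_zero, Matrix.cons_val_one]
  rcases le_or_gt c 0 with hc | hc
  · simp only [max_eq_right hc, mul_zero, zero_div, zero_add]
    fun_prop
  · rw [max_eq_left hc.le]
    have hpos (t : ℝ) : (max t 0) ^ 2 + c ^ 2 ≠ 0 := by positivity
    fun_prop (disch := exact hpos _)

theorem continuous_fgp_right (c : ℝ) : Continuous fun t : ℝ => fgp ![c, t] := by
  simpa only [fgp_swap c] using continuous_fgp_left c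

theorem continuousOn_fgp_of_isAxisLineIn {L : Set (Fin 2 → ℝ)}
    (hL : IsAxisLineIn Set.univ L) : ContinuousOn fgp L := by
  obtain ⟨p, i, rfl⟩ := hL
  fin_cases i
  · refine ((continuous_fgp_left (p 1)).comp (continuous_apply 0)).continuousOn.congr ?_
    rintro _ ⟨-, t, rfl⟩
    simp [fgp_eq_posPart]
  · refine ((continuous_fgp_right (p 0)).comp (continuous_apply 1)).continuousOn.congr ?_
    rintro _ ⟨-, t, rfl⟩
    simp [fgp_eq_posPart]

theorem fgp_zero : fgp 0 = 0 := by simp [fgp]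

theorem fgp_diag {l : ℝ} (hl : 0 < l) : fgp ![l, l] = 1 + l := by
  simp only [fgp_eq_posPart, Matrix.cons_val_zero, Matrix.cons_val_one, max_eq_left hl.le, min_self]
  field_simp
  ring

theorem fgp_one_quarter : fgp ![(1 : ℝ), 1 / 4] = 49 / 68 := by
  simp only [fgp_eq_posPart, Matrix.cons_val_zero, Matrix.cons_val_one]
  norm_num

theorem setOf_fgp_segment_eq_Ioc :
    {l : ℝ | l ∈ Set.Icc (0 : ℝ) 1 ∧
        fgp ![(1 : ℝ), 1 / 4] ≤ fgp (l • ![(1 : ℝ), 1] + (1 - l) • (0 : Fin 2 → ℝ))}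
      = Set.Ioc (0 : ℝ) 1 := by
  ext l
  have hseg : l • ![(1 : ℝ), 1] + (1 - l) • (0 : Fin 2 → ℝ) = ![l, l] := by simp
  simp only [mem_ofPred_eq, hseg, fgp_one_quarter, mem_Icc, mem_Ioc]
  constructor
  · rintro ⟨⟨h0, h1⟩, h⟩
    refine ⟨lt_of_le_of_ne h0 ?_, h1⟩
    rintro rfl
    norm_num [fgp_eq_posPart] at h
  · rintro ⟨h0, h1⟩
    refine ⟨⟨h0.le, h1⟩, ?_⟩
    rw [fgp_diag h0]
    linarith

theorem not_isClosed_Ioc_zero_one : ¬ IsClosed (Set.Ioc (0 : ℝ) 1) := by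
  intro h
  have h0 : (0 : ℝ) ∈ closure (Set.Ioc (0 : ℝ) 1) := by
    rw [closure_Ioc zero_ne_one]
    exact ⟨le_rfl, zero_le_one⟩
  rw [h.closure_eq] at h0
  exact lt_irrefl _ h0.1

/-- Example (Genocchi–Peano): the restriction of `f` to every axis-parallel
straight line is continuous, so the relation `x ≿ y ↔ f x ≥ f y` is separately
continuous; yet `≿` is not upper mixture continuous:
`{λ ∈ [0,1] : λ(1,1) + (1-λ)(0,0) ≿ (1,1/4)} = (0,1]` is not closed.  Indeed,
`f(λ,λ) = 1 + λ` for `λ > 0`, `f(0,0) = 0` and `f(1,1/4) = 49/68`. -/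
theorem example_gp :
    -- (i) separate continuity
    (∀ L, IsAxisLineIn (Set.univ : Set (Fin 2 → ℝ)) L → ContinuousOn fgp L) ∧
    (∀ x : Fin 2 → ℝ, ∀ L, IsAxisLineIn (Set.univ : Set (Fin 2 → ℝ)) L →
      IsClosed (Subtype.val ⁻¹' {y | fgp x ≤ fgp y} : Set L) ∧
        IsClosed (Subtype.val ⁻¹' {y | fgp y ≤ fgp x} : Set L)) ∧
    -- (ii) failure of upper mixture continuity
    ({l : ℝ | l ∈ Set.Icc (0 : ℝ) 1 ∧
        fgp ![(1 : ℝ), 1 / 4] ≤ fgp (l • ![(1 : ℝ), 1] + (1 - l) • (0 : Fin 2 → ℝ))}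
      = Set.Ioc (0 : ℝ) 1) ∧
    ¬ IsClosed {l : ℝ | l ∈ Set.Icc (0 : ℝ) 1 ∧
        fgp ![(1 : ℝ), 1 / 4] ≤ fgp (l • ![(1 : ℝ), 1] + (1 - l) • (0 : Fin 2 → ℝ))} ∧
    (∀ l : ℝ, 0 < l → fgp ![l, l] = 1 + l) ∧
    fgp (0 : Fin 2 → ℝ) = 0 ∧ fgp ![(1 : ℝ), 1 / 4] = 49 / 68 := by
  refine ⟨fun L hL => continuousOn_fgp_of_isAxisLineIn hL, fun x L hL => ?_,
    setOf_fgp_segment_eq_Ioc, ?_, fun l hl => fgp_diag hl, fgp_zero, fgp_one_quarter⟩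
  · have hc := (continuousOn_fgp_of_isAxisLineIn hL).domRestrict
    exact ⟨isClosed_le continuous_const hc, isClosed_le hc continuous_const⟩
  · rw [setOf_fgp_segment_eq_Ioc]
    exact not_isClosed_Ioc_zero_one
end
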